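/- arXiv:2508.05569 — 5 statements merged into one kernel-verified Lean document; each statement's English description precedes it below -/
import Mathlib

section
/- Let k ≥ 2 be an integer, let γ be a real number with 1 < γ < k, and let (a_n)_{n≥1} be a sequence of non-negative real numbers such that a_{n+m} ≤ a_n · a_m and a_{k·n} ≤ a_n^γ for all positive integers n, m. Then for every real τ > (log γ)/(log k) there exists a constant M > 0 such that a_n ≤ M · e^{n^τ} for all n ≥ 1. -/
/-- A submultiplicative sequence with `a (k * n) ≤ (a n) ^ γ`, where `γ = k ^ σ`, grows at most like
`exp (D * n ^ σ)`. -/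
theorem exists_le_exp_mul_rpow
    {k : ℕ} (hk : 2 ≤ k) {γ σ : ℝ} (hγ1 : 1 < γ) (hσ : 0 ≤ σ) (hkσ : (k : ℝ) ^ σ = γ)
    {a : ℕ → ℝ} (ha : ∀ n, 1 ≤ n → 0 ≤ a n)
    (hsub : ∀ m n, 1 ≤ m → 1 ≤ n → a (m + n) ≤ a m * a n)
    (hpow : ∀ n, 1 ≤ n → a (k * n) ≤ a n ^ γ) :
    ∃ D : ℝ, 0 ≤ D ∧ ∀ n, 1 ≤ n → a n ≤ Real.exp (D * (n : ℝ) ^ σ) := by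
  obtain ⟨L, hL0, hL⟩ : ∃ L : ℝ, 0 ≤ L ∧ ∀ r < k, a r ≤ Real.exp L := by
    refine ⟨∑ i ∈ Finset.range k, |a i|, by positivity, fun r hr => ?_⟩
    have h := Finset.single_le_sum (f := fun i => |a i|) (fun i _ => abs_nonneg (a i))
      (Finset.mem_range.2 hr)
    have h' := Real.add_one_le_exp (∑ i ∈ Finset.range k, |a i|)
    have h'' := le_abs_self (a r)
    linarith
  have hγ0 : 0 < γ - 1 := sub_pos.2 hγ1
  set E : ℝ := L / (γ - 1) with hE
  have hE0 : 0 ≤ E := by positivity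
  have hEL : (γ - 1) * E = L := by rw [hE]; field_simp
  -- The correction term `- E` absorbs the remainder of the division by `k`.
  have key : ∀ n : ℕ, 1 ≤ n → a n ≤ Real.exp ((L + E) * (n : ℝ) ^ σ - E) := by
    intro n
    induction n using Nat.strong_induction_on with
    | _ n ih =>
      intro hn
      rcases lt_or_ge n k with hnk | hnk
      · refine (hL n hnk).trans (Real.exp_le_exp.2 ?_)
        have : (1 : ℝ) ≤ (n : ℝ) ^ σ := Real.one_le_rpow (by exact_mod_cast hn) hσ
        nlinarith
      · have hq : 1 ≤ n / k := (Nat.one_le_div_iff (by omega)).2 hnk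
        have hkq : 1 ≤ k * (n / k) := Nat.mul_pos (by omega) hq
        have hmul : a (k * (n / k)) ≤
            Real.exp (((L + E) * ((n / k : ℕ) : ℝ) ^ σ - E) * γ) := by
          rw [Real.exp_mul]
          exact (hpow _ hq).trans (Real.rpow_le_rpow (ha _ hq)
            (ih _ (Nat.div_lt_self (by omega) (by omega)) hq) (by linarith))
        have hrem : a n ≤ a (k * (n / k)) * Real.exp L := by
          rcases Nat.eq_zero_or_pos (n % k) with hr | hr
          · have hn' : k * (n / k) = n := by have := Nat.div_add_mod n k; omega
            rw [hn']
            exact le_mul_of_one_le_right (ha n hn) (Real.one_le_exp hL0)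
          · have h := hsub _ _ hkq hr
            rw [Nat.div_add_mod] at h
            exact h.trans (mul_le_mul_of_nonneg_left
              (hL _ (Nat.mod_lt _ (by omega))) (ha _ hkq))
        have hscale : γ * ((n / k : ℕ) : ℝ) ^ σ ≤ (n : ℝ) ^ σ := by
          rw [← hkσ, ← Real.mul_rpow (by positivity) (by positivity)]
          exact Real.rpow_le_rpow (by positivity) (by exact_mod_cast Nat.mul_div_le n k) hσ
        refine hrem.trans ((mul_le_mul_of_nonneg_right hmul (Real.exp_pos L).le).trans ?_)
        rw [← Real.exp_add]
        refine Real.exp_le_exp.2 ?_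
        have := mul_le_mul_of_nonneg_left hscale (add_nonneg hL0 hE0)
        linarith
  exact ⟨L + E, by positivity, fun n hn =>
    (key n hn).trans (Real.exp_le_exp.2 (sub_le_self _ hE0))⟩

/-- If `(a_n)` is a submultiplicative sequence of non-negative reals
satisfying `a (k*n) ≤ (a n) ^ γ` with `1 < γ < k`, then for every `τ > log γ / log k`
there is `M > 0` with `a n ≤ M * exp (n ^ τ)` for all `n ≥ 1`. -/
theorem stmt1
    (k : ℕ) (hk : 2 ≤ k) (γ : ℝ) (hγ1 : 1 < γ) (hγk : γ < (k : ℝ))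
    (a : ℕ → ℝ) (ha : ∀ n, 1 ≤ n → 0 ≤ a n)
    (hsub : ∀ m n, 1 ≤ m → 1 ≤ n → a (m + n) ≤ a m * a n)
    (hpow : ∀ n, 1 ≤ n → a (k * n) ≤ a n ^ γ)
    (τ : ℝ) (hτ : Real.log γ / Real.log k < τ) :
    ∃ M : ℝ, 0 < M ∧ ∀ n, 1 ≤ n → a n ≤ M * Real.exp ((n : ℝ) ^ τ) := by
  have hk1 : (1 : ℝ) < k := by exact_mod_cast hk
  have hlogk : 0 < Real.log k := Real.log_pos hk1
  set σ : ℝ := Real.log γ / Real.log k with hσ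
  have hσ0 : 0 ≤ σ := div_nonneg (Real.log_pos hγ1).le hlogk.le
  have hkσ : (k : ℝ) ^ σ = γ := by
    rw [Real.rpow_def_of_pos (by linarith), hσ, mul_div_cancel₀ _ hlogk.ne',
      Real.exp_log (by linarith)]
  obtain ⟨D, hD0, hD⟩ := exists_le_exp_mul_rpow hk hγ1 hσ0 hkσ ha hsub hpow
  obtain ⟨N, hN⟩ := Filter.eventually_atTop.1
    (((tendsto_rpow_atTop (sub_pos.2 hτ)).comp
      tendsto_natCast_atTop_atTop).eventually_ge_atTop D)
  refine ⟨Real.exp (D * (N : ℝ) ^ σ), Real.exp_pos _, fun n hn => (hD n hn).trans ?_⟩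
  rw [← Real.exp_add]
  refine Real.exp_le_exp.2 ?_
  have hn0 : (0 : ℝ) < n := by exact_mod_cast hn
  rcases le_total N n with h | h
  · have hDn : D ≤ (n : ℝ) ^ (τ - σ) := hN n h
    have hmul : D * (n : ℝ) ^ σ ≤ (n : ℝ) ^ τ := by
      calc D * (n : ℝ) ^ σ ≤ (n : ℝ) ^ (τ - σ) * (n : ℝ) ^ σ := by gcongr
        _ = (n : ℝ) ^ τ := by rw [← Real.rpow_add hn0, sub_add_cancel]
    have : 0 ≤ D * (N : ℝ) ^ σ := by positivity
    linarith
  · have : D * (n : ℝ) ^ σ ≤ D * (N : ℝ) ^ σ := by gcongr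
    have : 0 ≤ (n : ℝ) ^ τ := by positivity
    linarith
end

section
/- Suppose the unital (k,p,q)-differential condition holds. Then for every a ∈ A the spectral radius of a computed in A equals the spectral radius of ι(a) computed in B; that is, lim_n ‖a^n‖_A^{1/n} = lim_n ‖ι(a)^n‖_B^{1/n}. -/
/-- The spectral radius of an element of a Banach algebra is finite. -/
theorem spectralRadius_ne_top (𝕜 : Type*) {A : Type*} [NormedField 𝕜] [NormedRing A]
    [NormedAlgebra 𝕜 A] [CompleteSpace A] (a : A) : spectralRadius 𝕜 a ≠ ⊤ := by
  refine ne_top_of_le_ne_top ?_ (spectrum.spectralRadius_le_pow_nnnorm_pow_one_div 𝕜 a 0)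
  finiteness

open Filter Topology in
/-- Gelfand's formula in a complex Banach algebra, as a limit of real numbers. -/
theorem tendsto_norm_pow_rpow_toReal_spectralRadius
    {A : Type*} [NormedRing A] [NormedAlgebra ℂ A] [CompleteSpace A] (a : A) :
    Tendsto (fun n : ℕ => ‖a ^ n‖ ^ (1 / n : ℝ)) atTop (𝓝 (spectralRadius ℂ a).toReal) := by
  have h := (ENNReal.tendsto_toReal (spectralRadius_ne_top ℂ a)).comp
    (spectrum.pow_norm_pow_one_div_tendsto_nhds_spectralRadius a)
  refine h.congr fun n => ?_
  exact ENNReal.toReal_ofReal (by positivity)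

open Filter Topology in
/-- In a unital `(k,p,q)`-differential subalgebra, the spectral radius of
any `a ∈ A` computed in `A` agrees with the spectral radius of `ι a` computed in `B`. -/
theorem stmt4
    {A B : Type*}
    [NormedRing A] [StarRing A] [NormedAlgebra ℂ A] [CompleteSpace A]
    [CStarAlgebra B]
    (hstar : Continuous (star : A → A))
    (ι : A →⋆ₐ[ℂ] B) (hinj : Function.Injective ι) (hcont : Continuous ι)
    (k : ℕ) (hk : 2 ≤ k) (p q : ℝ) (hp : 0 < p) (hq : 0 < q) (hpq : p + q = (k : ℝ))
    (C : ℝ) (hC : 0 < C)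
    (hdiff : ∀ a : A, ‖a ^ k‖ ≤ C * ‖a‖ ^ p * ‖ι a‖ ^ q) :
    ∀ a : A, spectralRadius ℂ a = spectralRadius ℂ (ι a) := by
  intro a
  refine le_antisymm ?_ (biSup_mono fun z hz => AlgHom.spectrum_apply_subset ι a hz)
  have hA := tendsto_norm_pow_rpow_toReal_spectralRadius a
  have hB := tendsto_norm_pow_rpow_toReal_spectralRadius (ι a)
  rw [← ENNReal.toReal_le_toReal (spectralRadius_ne_top ℂ a) (spectralRadius_ne_top ℂ (ι a))]
  set r := (spectralRadius ℂ a).toReal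
  set s := (spectralRadius ℂ (ι a)).toReal
  have hr : 0 ≤ r := ENNReal.toReal_nonneg
  have hs : 0 ≤ s := ENNReal.toReal_nonneg
  have hL : Tendsto (fun n : ℕ => (‖a ^ (n * k)‖ ^ (1 / (n * k : ℕ) : ℝ)) ^ k) atTop
      (𝓝 (r ^ k)) :=
    (hA.comp (tendsto_id.atTop_mul_const' (by lia : 0 < k))).pow k
  have hC1 : Tendsto (fun n : ℕ => C ^ (1 / n : ℝ)) atTop (𝓝 1) := by
    simpa using (tendsto_const_nhds (x := C)).rpow
      (tendsto_one_div_atTop_nhds_zero_nat (𝕜 := ℝ)) (Or.inl hC.ne')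
  have hR := (hC1.mul (hA.rpow_const (p := p) (Or.inr hp.le))).mul
    (hB.rpow_const (p := q) (Or.inr hq.le))
  have key : r ^ k ≤ 1 * r ^ p * s ^ q := by
    refine le_of_tendsto_of_tendsto hL hR ?_
    filter_upwards [eventually_gt_atTop 0] with n hn
    have hn' : (n : ℝ) ≠ 0 := by positivity
    have hk' : (k : ℝ) ≠ 0 := by positivity
    calc (‖a ^ (n * k)‖ ^ (1 / (n * k : ℕ) : ℝ)) ^ k
        = ‖(a ^ n) ^ k‖ ^ (1 / n : ℝ) := by
          rw [← Real.rpow_natCast, ← Real.rpow_mul (norm_nonneg _), pow_mul]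
          congr 1
          push_cast
          field_simp
      _ ≤ (C * ‖a ^ n‖ ^ p * ‖ι a ^ n‖ ^ q) ^ (1 / n : ℝ) := by
          have := hdiff (a ^ n)
          rw [map_pow] at this
          gcongr
      _ = _ := by
          rw [Real.mul_rpow (by positivity) (by positivity), Real.mul_rpow hC.le (by positivity),
            ← Real.rpow_mul (norm_nonneg _), ← Real.rpow_mul (norm_nonneg _),
            ← Real.rpow_mul (norm_nonneg _), ← Real.rpow_mul (norm_nonneg _),
            mul_comm p, mul_comm q]
  rcases hr.eq_or_lt with h0 | h0
  · exact h0 ▸ hs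
  · rw [one_mul, ← Real.rpow_natCast, ← hpq, Real.rpow_add h0] at key
    exact (Real.rpow_le_rpow_iff hr hs hq).1 (le_of_mul_le_mul_left key (by positivity))
end

section
/- Suppose the unital (k,p,q)-differential condition holds. Then for every a ∈ A the spectrum of a in A equals the spectrum of ι(a) in B: Spec_A(a) = Spec_B(ι(a)). In particular A is symmetric: for every self-adjoint a ∈ A the spectrum Spec_A(a) is contained in ℝ, and for every a ∈ A the spectrum Spec_A(a*·a) is contained in the non-negative reals [0, ∞). -/
open Filter Topology in
/-- A differential estimate `‖a ^ k‖ ≤ C * ‖a‖ ^ p * ‖ι a‖ ^ q` with `p + q = k` forces `ι` not to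
decrease the spectral radius. -/
theorem spectralRadius_toReal_le_of_norm_pow_le {A B : Type*}
    [NormedRing A] [NormedAlgebra ℂ A] [CompleteSpace A]
    [NormedRing B] [NormedAlgebra ℂ B] [CompleteSpace B]
    (ι : A →ₐ[ℂ] B) {k : ℕ} (hk : 0 < k) {p q : ℝ} (hp : 0 < p) (hq : 0 < q)
    (hpq : p + q = (k : ℝ)) {C : ℝ} (hC : 0 < C)
    (hdiff : ∀ a : A, ‖a ^ k‖ ≤ C * ‖a‖ ^ p * ‖ι a‖ ^ q) (a : A) :
    (spectralRadius ℂ a).toReal ≤ (spectralRadius ℂ (ι a)).toReal := by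
  have hA := tendsto_norm_pow_rpow_toReal_spectralRadius a
  have hB := tendsto_norm_pow_rpow_toReal_spectralRadius (ι a)
  set r := (spectralRadius ℂ a).toReal
  set s := (spectralRadius ℂ (ι a)).toReal
  have hr : 0 ≤ r := ENNReal.toReal_nonneg
  have hs : 0 ≤ s := ENNReal.toReal_nonneg
  have hinv : Tendsto (fun n : ℕ => C ^ (1 / n : ℝ)) atTop (𝓝 1) := by
    simpa using tendsto_const_nhds.rpow tendsto_one_div_atTop_nhds_zero_nat (Or.inl hC.ne')
  have hleft : Tendsto (fun n : ℕ => (‖a ^ (n * k)‖ ^ (1 / (n * k : ℕ) : ℝ)) ^ (k : ℝ)) atTop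
      (𝓝 (r ^ (k : ℝ))) :=
    (hA.comp (tendsto_id.atTop_mul_const' hk)).rpow_const (Or.inr k.cast_nonneg)
  have hright := (hinv.mul (hA.rpow_const (Or.inr hp.le))).mul (hB.rpow_const (Or.inr hq.le))
  have hle : r ^ (k : ℝ) ≤ 1 * r ^ p * s ^ q := by
    refine le_of_tendsto_of_tendsto hleft hright ?_
    filter_upwards [eventually_gt_atTop 0] with n hn
    have hn' : (n : ℝ) ≠ 0 := by positivity
    have hk' : (k : ℝ) ≠ 0 := by positivity
    have h := Real.rpow_le_rpow (norm_nonneg _) (hdiff (a ^ n)) (by positivity : 0 ≤ (1 / n : ℝ))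
    rw [Real.mul_rpow (by positivity) (by positivity), Real.mul_rpow hC.le (by positivity),
      ← Real.rpow_mul (norm_nonneg _) p, mul_comm p, Real.rpow_mul (norm_nonneg _) _ p,
      ← Real.rpow_mul (norm_nonneg _) q, mul_comm q, Real.rpow_mul (norm_nonneg _) _ q, map_pow,
      ← pow_mul] at h
    refine le_of_eq_of_le ?_ h
    rw [← Real.rpow_mul (norm_nonneg _)]
    congr 1
    push_cast
    field_simp
  rcases hr.eq_or_lt with h0 | h0
  · rwa [← h0]
  · rw [← hpq, Real.rpow_add h0, one_mul] at hle
    exact (Real.rpow_le_rpow_iff hr hs hq).1 (le_of_mul_le_mul_left hle (by positivity))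

open scoped ComplexOrder in
/-- The spectrum of `b⋆ * b` in a C⋆-algebra consists of non-negative reals. -/
theorem exists_nonneg_eq_of_mem_spectrum_star_mul_self {B : Type*} [CStarAlgebra B] {b : B} {z : ℂ}
    (hz : z ∈ spectrum ℂ (star b * b)) : ∃ r : ℝ, 0 ≤ r ∧ z = (r : ℂ) := by
  let _ := CStarAlgebra.spectralOrder B
  have := CStarAlgebra.spectralOrderedRing B
  obtain ⟨x, hx, rfl⟩ := RCLike.nonneg_iff_exists_ofReal.1
    (spectrum_nonneg_of_nonneg (star_mul_self_nonneg b) hz)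
  exact ⟨x, hx, rfl⟩

/-- In a C⋆-algebra, if `b` is invertible then `b⋆ * b` is strictly closer, in spectral radius, to
some scalar `M` than `M` is to zero. -/
theorem exists_spectralRadius_algebraMap_sub_star_mul_self_lt {B : Type*} [CStarAlgebra B]
    [Nontrivial B] {b : B} (hb : IsUnit b) :
    ∃ M : ℝ, (spectralRadius ℂ (algebraMap ℂ B M - star b * b)).toReal < M := by
  refine ⟨‖star b * b‖ + 1, ?_⟩
  set M : ℝ := ‖star b * b‖ + 1
  obtain ⟨z, hz, hzr⟩ :=
    spectrum.exists_nnnorm_eq_spectralRadius (algebraMap ℂ B M - star b * b)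
  rw [← hzr, ENNReal.coe_toReal, coe_nnnorm]
  rw [← spectrum.singleton_sub_eq, Set.singleton_sub] at hz
  obtain ⟨w, hw, rfl⟩ := hz
  have hne : w ≠ 0 := spectrum.ne_zero_of_mem_of_unit (a := (hb.star.mul hb).unit) hw
  have hwn : ‖w‖ ≤ ‖star b * b‖ := spectrum.norm_le_norm_of_mem hw
  obtain ⟨x, hx, rfl⟩ := exists_nonneg_eq_of_mem_spectrum_star_mul_self hw
  have hx0 : x ≠ 0 := by exact_mod_cast hne
  have hxn : x ≤ ‖star b * b‖ := by simpa [abs_of_nonneg hx] using hwn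
  have hxp := hx.lt_of_ne' hx0
  simp only [← Complex.ofReal_sub, Complex.norm_real, Real.norm_eq_abs, M]
  rw [abs_lt]
  constructor <;> linarith

/-- An element within spectral radius less than `M` of the scalar `M` is invertible. -/
theorem isUnit_of_spectralRadius_algebraMap_sub_lt {A : Type*} [NormedRing A] [NormedAlgebra ℂ A]
    [CompleteSpace A] {c : A} {M : ℝ}
    (h : (spectralRadius ℂ (algebraMap ℂ A M - c)).toReal < M) : IsUnit c := by
  have hfin : spectralRadius ℂ (algebraMap ℂ A M - c) ≠ ⊤ :=
    ((spectrum.spectralRadius_le_pow_nnnorm_pow_one_div ℂ _ 0).trans_lt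
      (by finiteness)).ne
  have hM : 0 ≤ M := ENNReal.toReal_nonneg.trans h.le
  have hmem : (M : ℂ) ∈ resolventSet ℂ (algebraMap ℂ A M - c) := by
    refine spectrum.mem_resolventSet_of_spectralRadius_lt ?_
    rw [← ENNReal.toReal_lt_toReal hfin ENNReal.coe_ne_top]
    simpa [abs_of_nonneg hM] using h
  simpa [spectrum.mem_resolventSet_iff] using hmem

/-- A star homomorphism into a C⋆-algebra that does not decrease spectral radii reflects
invertibility. -/
theorem isUnit_of_isUnit_map_of_spectralRadius_le {A B : Type*}
    [NormedRing A] [StarRing A] [NormedAlgebra ℂ A] [CompleteSpace A] [CStarAlgebra B]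
    [Nontrivial B] (ι : A →⋆ₐ[ℂ] B)
    (hrad : ∀ a : A, (spectralRadius ℂ a).toReal ≤ (spectralRadius ℂ (ι a)).toReal)
    {a : A} (ha : IsUnit (ι a)) : IsUnit a := by
  have key (b : A) (hb : IsUnit (ι b)) : IsUnit (star b * b) := by
    obtain ⟨M, hM⟩ := exists_spectralRadius_algebraMap_sub_star_mul_self_lt hb
    refine isUnit_of_spectralRadius_algebraMap_sub_lt (M := M) ((hrad _).trans_lt ?_)
    simpa [AlgHomClass.commutes, map_star] using hM
  have hl := key a ha
  have hr := key (star a) (by simpa [map_star] using ha)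
  rw [star_star] at hr
  obtain ⟨u, hu⟩ := hl
  obtain ⟨v, hv⟩ := hr
  refine isUnit_iff_exists_and_exists.2 ⟨⟨star a * ↑v⁻¹, ?_⟩, ⟨↑u⁻¹ * star a, ?_⟩⟩
  · rw [← mul_assoc, ← hv, Units.mul_inv]
  · rw [mul_assoc, ← hu, Units.inv_mul]

/-- In a unital `(k,p,q)`-differential subalgebra, spectra are preserved:
`Spec_A a = Spec_B (ι a)` for all `a ∈ A`.  In particular `A` is symmetric: self-adjoint
elements have real spectrum, and the spectrum of `a⋆ * a` is contained in `[0, ∞)`. -/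
theorem stmt5
    {A B : Type*}
    [NormedRing A] [StarRing A] [NormedAlgebra ℂ A] [CompleteSpace A]
    [CStarAlgebra B]
    (hstar : Continuous (star : A → A))
    (ι : A →⋆ₐ[ℂ] B) (hinj : Function.Injective ι) (hcont : Continuous ι)
    (k : ℕ) (hk : 2 ≤ k) (p q : ℝ) (hp : 0 < p) (hq : 0 < q) (hpq : p + q = (k : ℝ))
    (C : ℝ) (hC : 0 < C)
    (hdiff : ∀ a : A, ‖a ^ k‖ ≤ C * ‖a‖ ^ p * ‖ι a‖ ^ q) :
    (∀ a : A, spectrum ℂ a = spectrum ℂ (ι a)) ∧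
    (∀ a : A, star a = a → ∀ z ∈ spectrum ℂ a, ∃ r : ℝ, z = (r : ℂ)) ∧
    (∀ a : A, ∀ z ∈ spectrum ℂ (star a * a), ∃ r : ℝ, 0 ≤ r ∧ z = (r : ℂ)) := by
  have hspec (a : A) : spectrum ℂ a = spectrum ℂ (ι a) := by
    refine Set.Subset.antisymm (fun z hz => ?_) (AlgHom.spectrum_apply_subset ι a)
    rcases subsingleton_or_nontrivial B with _ | _
    · have := hinj.subsingleton
      simp [spectrum.of_subsingleton] at hz
    · rw [spectrum.mem_iff] at hz ⊢
      refine fun h => hz (isUnit_of_isUnit_map_of_spectralRadius_le ι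
        (spectralRadius_toReal_le_of_norm_pow_le (ι : A →ₐ[ℂ] B) (by omega) hp hq hpq hC hdiff) ?_)
      simpa [AlgHomClass.commutes] using h
  refine ⟨hspec, fun a ha z hz => ?_, fun a z hz => ?_⟩
  · rw [hspec] at hz
    have hsa : IsSelfAdjoint (ι a) := by rw [IsSelfAdjoint, ← map_star, ha]
    exact ⟨z.re, hsa.mem_spectrum_eq_re hz⟩
  · rw [hspec, map_mul, map_star] at hz
    exact exists_nonneg_eq_of_mem_spectrum_star_mul_self hz
end

section
/- Suppose the unital (k,p,q)-differential condition holds and let a ∈ A be self-adjoint. Let S denote the topological closure in A of the unital subalgebra generated by a (so S is a commutative unital Banach algebra). Then S is regular: for every closed subset X of the character space of S (the set of non-zero continuous unital ℂ-algebra homomorphisms S → ℂ, with the weak-* topology) and every character ω with ω ∉ X, there exists b ∈ S such that φ(b) = 0 for all φ ∈ X and ω(b) ≠ 0. -/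
open Real Filter Topology

theorem integral_exp_average (θ x ε : ℝ) :
    ∫ y in (x - ε)..(x + ε), Complex.exp ((θ * y : ℝ) * Complex.I) =
      (2 * ε : ℝ) * (sinc (θ * ε) * Complex.exp ((θ * x : ℝ) * Complex.I)) := by
  have h : ∀ y : ℝ, Complex.exp ((θ * (y + x) : ℝ) * Complex.I) =
      Complex.exp ((θ * y : ℝ) * Complex.I) * Complex.exp ((θ * x : ℝ) * Complex.I) := by
    intro y
    rw [← Complex.exp_add]
    push_cast
    ring_nf
  have h1 : ∫ y in (x - ε)..(x + ε), Complex.exp ((θ * y : ℝ) * Complex.I) =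
      ∫ y in (-ε)..ε, Complex.exp ((θ * (y + x) : ℝ) * Complex.I) := by
    rw [intervalIntegral.integral_comp_add_right
      (fun y : ℝ => Complex.exp ((θ * y : ℝ) * Complex.I))]
    ring_nf
  rw [h1]
  simp_rw [h]
  rw [intervalIntegral.integral_mul_const]
  rcases eq_or_ne θ 0 with rfl | hθ
  · simp; ring
  · rw [intervalIntegral.integral_comp_mul_left
      (fun y : ℝ => Complex.exp ((y : ℝ) * Complex.I)) hθ, mul_neg, integral_exp_mul_I_eq_sinc]
    have : (θ : ℂ) ≠ 0 := by exact_mod_cast hθ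
    simp
    field_simp

/-- The sum of the trigonometric series `∑ cₙ exp (i θ n x)`. -/
noncomputable def trigSum (θ : ℝ) (c : ℤ → ℂ) (x : ℝ) : ℂ :=
  ∑' n : ℤ, c n * Complex.exp ((θ * n * x : ℝ) * Complex.I)

theorem trigSum_sinc_eq {θ ε x : ℝ} (hε : 0 < ε) {c : ℤ → ℂ} (hc : Summable fun n => ‖c n‖) {v : ℂ}
    (h : ∀ y, |y - x| ≤ ε → trigSum θ c y = v) :
    trigSum θ (fun n => c n * sinc (θ * n * ε)) x = v := by
  have key := intervalIntegral.hasSum_integral_of_dominated_convergence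
    (F := fun (n : ℤ) (y : ℝ) => c n * Complex.exp ((θ * n * y : ℝ) * Complex.I))
    (f := fun _ => v) (μ := MeasureTheory.volume) (a := x - ε) (b := x + ε)
    (fun n _ => ‖c n‖) (fun n => by fun_prop)
    (fun n => by
      filter_upwards with y hy
      rw [norm_mul, Complex.norm_exp_ofReal_mul_I, mul_one])
    (by filter_upwards with y hy using hc) (by simp)
    (by
      filter_upwards with y hy
      rw [Set.uIoc_of_le (by linarith)] at hy
      rw [← h y (by rw [abs_le]; constructor <;> linarith [hy.1, hy.2])]
      refine Summable.hasSum (Summable.of_norm ?_)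
      simpa only [norm_mul, Complex.norm_exp_ofReal_mul_I, mul_one] using hc)
  simp_rw [intervalIntegral.integral_const_mul, integral_exp_average] at key
  have h2 : ((2 * ε : ℝ) : ℂ) ≠ 0 := by exact_mod_cast (by positivity)
  have := (key.mul_left ((2 * ε : ℝ) : ℂ)⁻¹).tsum_eq
  have h3 : (((2 * ε : ℝ) : ℂ)⁻¹ * ∫ y in (x - ε)..(x + ε), v) = v := by
    rw [intervalIntegral.integral_const, show x + ε - (x - ε) = 2 * ε by ring, Complex.real_smul,
      inv_mul_cancel_left₀ h2]
  rw [h3] at this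
  rw [← this, trigSum]
  refine tsum_congr fun n => ?_
  generalize ((2 * ε : ℝ) : ℂ) = w at h2 ⊢
  field_simp

theorem trigSum_sinc_sq_eq {θ ε x : ℝ} (hε : 0 < ε) {c : ℤ → ℂ} (hc : Summable fun n => ‖c n‖)
    {v : ℂ} (h : ∀ y, |y - x| ≤ 2 * ε → trigSum θ c y = v) :
    trigSum θ (fun n => c n * (sinc (θ * n * ε) ^ 2 : ℝ)) x = v := by
  have hc' : Summable fun n => ‖c n * sinc (θ * n * ε)‖ := by
    refine hc.of_nonneg_of_le (fun n => norm_nonneg _) fun n => ?_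
    rw [norm_mul, Complex.norm_real]
    exact mul_le_of_le_one_right (norm_nonneg _) (abs_sinc_le_one _)
  have := trigSum_sinc_eq (θ := θ) (x := x) hε hc' (v := v) fun y hy =>
    trigSum_sinc_eq hε hc fun z hz => h z (by
      have := abs_sub_le z y x
      linarith)
  rw [← this]
  congr 1
  ext n
  push_cast
  ring

/-- Partial products of squared `sinc` multipliers with step sizes `ε j`. -/
noncomputable def sincProd (ε : ℕ → ℝ) (J : ℕ) (t : ℝ) : ℝ :=
  ∏ j ∈ Finset.range J, sinc (t * ε j) ^ 2

theorem sincProd_nonneg (ε : ℕ → ℝ) (J : ℕ) (t : ℝ) : 0 ≤ sincProd ε J t :=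
  Finset.prod_nonneg fun _ _ => sq_nonneg _

theorem sincProd_antitone (ε : ℕ → ℝ) (t : ℝ) : Antitone fun J => sincProd ε J t := by
  refine antitone_nat_of_succ_le fun J => ?_
  rw [sincProd, Finset.prod_range_succ]
  exact mul_le_of_le_one_right (sincProd_nonneg ε J t)
    ((sq_le_one_iff_abs_le_one _).2 (abs_sinc_le_one _))

theorem sincProd_le_one (ε : ℕ → ℝ) (J : ℕ) (t : ℝ) : sincProd ε J t ≤ 1 := by
  simpa [sincProd] using sincProd_antitone ε t (Nat.zero_le J)

theorem trigSum_sincProd_eq {θ : ℝ} {ε : ℕ → ℝ} (hε : ∀ j, 0 < ε j) {c : ℤ → ℂ}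
    (hc : Summable fun n => ‖c n‖) {v : ℂ} (J : ℕ) :
    ∀ x : ℝ, (∀ y, |y - x| ≤ 2 * ∑ j ∈ Finset.range J, ε j → trigSum θ c y = v) →
      trigSum θ (fun n => c n * sincProd ε J (θ * n)) x = v := by
  induction J with
  | zero =>
    intro x h
    simpa [sincProd] using h x (by simp)
  | succ J ih =>
    intro x h
    have hc' : Summable fun n => ‖c n * sincProd ε J (θ * n)‖ := by
      refine hc.of_nonneg_of_le (fun n => norm_nonneg _) fun n => ?_
      rw [norm_mul, Complex.norm_real]
      refine mul_le_of_le_one_right (norm_nonneg _) ?_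
      rw [Real.norm_of_nonneg (sincProd_nonneg _ _ _)]
      exact sincProd_le_one _ _ _
    have := trigSum_sinc_sq_eq (θ := θ) (x := x) (hε J) hc' (v := v) fun y hy =>
      ih y fun z hz => h z (by
        have := abs_sub_le z y x
        rw [Finset.sum_range_succ]
        linarith)
    rw [← this]
    congr 1
    ext n
    rw [sincProd, sincProd, Finset.prod_range_succ]
    push_cast
    ring

/-- The limit of the partial products `sincProd`. -/
noncomputable def sincProdLim (ε : ℕ → ℝ) (t : ℝ) : ℝ := ⨅ J, sincProd ε J t

theorem bddBelow_sincProd (ε : ℕ → ℝ) (t : ℝ) : BddBelow (Set.range fun J => sincProd ε J t) :=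
  ⟨0, by rintro _ ⟨J, rfl⟩; exact sincProd_nonneg ε J t⟩

theorem sincProdLim_le (ε : ℕ → ℝ) (J : ℕ) (t : ℝ) : sincProdLim ε t ≤ sincProd ε J t :=
  ciInf_le (bddBelow_sincProd ε t) J

theorem sincProdLim_nonneg (ε : ℕ → ℝ) (t : ℝ) : 0 ≤ sincProdLim ε t :=
  le_ciInf fun J => sincProd_nonneg ε J t

theorem trigSum_sincProdLim_eq {θ δ : ℝ} {ε : ℕ → ℝ} (hε : ∀ j, 0 < ε j)
    (hδ : ∀ J, 2 * ∑ j ∈ Finset.range J, ε j ≤ δ) {c : ℤ → ℂ}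
    (hc : Summable fun n => ‖c n‖) {v : ℂ} {x : ℝ}
    (h : ∀ y, |y - x| ≤ δ → trigSum θ c y = v) :
    trigSum θ (fun n => c n * sincProdLim ε (θ * n)) x = v := by
  have h1 : ∀ J, trigSum θ (fun n => c n * sincProd ε J (θ * n)) x = v := fun J =>
    trigSum_sincProd_eq hε hc J x fun y hy => h y (hy.trans (hδ J))
  have h2 : Tendsto (fun J => trigSum θ (fun n => c n * sincProd ε J (θ * n)) x) atTop
      (𝓝 (trigSum θ (fun n => c n * sincProdLim ε (θ * n)) x)) := by
    refine tendsto_tsum_of_dominated_convergence hc (fun n => ?_) (Eventually.of_forall fun J n => ?_)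
    · refine Tendsto.mul_const _ (Tendsto.const_mul _ ?_)
      exact (Complex.continuous_ofReal.tendsto _).comp
        (tendsto_atTop_ciInf (sincProd_antitone ε _) (bddBelow_sincProd ε _))
    · rw [norm_mul, Complex.norm_exp_ofReal_mul_I, mul_one, norm_mul, Complex.norm_real,
        Real.norm_of_nonneg (sincProd_nonneg _ _ _)]
      exact mul_le_of_le_one_right (norm_nonneg _) (sincProd_le_one _ _ _)
  simp_rw [h1] at h2
  exact tendsto_nhds_unique h2 tendsto_const_nhds

theorem sincProdLim_le_exp {γ r : ℝ} (hγ : 0 < γ) (hγ1 : γ < 1) (hr : 0 < r) (K : ℝ) :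
    ∃ ε : ℕ → ℝ, (∀ j, 0 < ε j) ∧ (∀ J, 2 * ∑ j ∈ Finset.range J, ε j ≤ r) ∧
      ∃ t₀ : ℝ, ∀ t : ℝ, t₀ ≤ |t| → sincProdLim ε t * exp (K * |t| ^ γ) ≤ exp 1 := by
  obtain ⟨γ', hγγ', hγ'1⟩ := exists_between hγ1
  have hγ'0 : 0 < γ' := hγ.trans hγγ'
  have hβ : 1 < γ'⁻¹ := (one_lt_inv₀ hγ'0).2 hγ'1
  have hs : Summable fun j : ℕ => 1 / ((j : ℝ) + 1) ^ γ'⁻¹ := by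
    have := (summable_nat_add_iff 1).2 (Real.summable_one_div_nat_rpow.2 hβ)
    simpa using this
  set S := ∑' j : ℕ, 1 / ((j : ℝ) + 1) ^ γ'⁻¹ with hS
  have hSpos : 0 < S := hs.tsum_pos (fun j => by positivity) 0 (by positivity)
  set r' := r / (2 * S) with hr'
  have hr'0 : 0 < r' := by positivity
  refine ⟨fun j => r' * (1 / ((j : ℝ) + 1) ^ γ'⁻¹), fun j => by positivity, fun J => ?_, ?_⟩
  · rw [← Finset.mul_sum]
    have := hs.sum_le_tsum (Finset.range J) (fun j _ => by positivity)
    calc 2 * (r' * ∑ j ∈ Finset.range J, 1 / ((j : ℝ) + 1) ^ γ'⁻¹) ≤ 2 * (r' * S) := by gcongr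
      _ = r := by rw [hr']; field_simp
  · set κ := r' / exp 1 with hκ
    have hκ0 : 0 < κ := by positivity
    have hev : ∀ᶠ t : ℝ in atTop, K ≤ κ ^ γ' * t ^ (γ' - γ) :=
      ((tendsto_rpow_atTop (by linarith)).const_mul_atTop (by positivity)).eventually_ge_atTop K
    obtain ⟨t₀, ht₀⟩ := (hev.and (eventually_gt_atTop 0)).exists_forall_of_atTop
    refine ⟨t₀, fun t ht => ?_⟩
    obtain ⟨h1, ht0⟩ := ht₀ _ ht
    set N := ⌊(κ * |t|) ^ γ'⌋₊ with hN
    have hprod : sincProdLim (fun j => r' * (1 / ((j : ℝ) + 1) ^ γ'⁻¹)) t ≤ exp (-N) := by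
      refine (sincProdLim_le _ N t).trans ?_
      have : exp (-N) = ∏ _j ∈ Finset.range N, exp (-1) := by
        rw [Finset.prod_const, Finset.card_range, ← exp_nat_mul]
        ring_nf
      rw [this]
      refine Finset.prod_le_prod (fun _ _ => sq_nonneg _) fun j hj => ?_
      rw [Finset.mem_range] at hj
      have hjN : (j : ℝ) + 1 ≤ (κ * |t|) ^ γ' := by
        have : ((j + 1 : ℕ) : ℝ) ≤ N := by exact_mod_cast hj
        push_cast at this
        exact this.trans (Nat.floor_le (by positivity))
      have hjN' : ((j : ℝ) + 1) ^ γ'⁻¹ ≤ κ * |t| := by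
        calc ((j : ℝ) + 1) ^ γ'⁻¹ ≤ ((κ * |t|) ^ γ') ^ γ'⁻¹ := by gcongr
          _ = κ * |t| := by rw [← rpow_mul (by positivity), mul_inv_cancel₀ hγ'0.ne', rpow_one]
      set y := t * (r' * (1 / ((j : ℝ) + 1) ^ γ'⁻¹)) with hy
      have hye : exp 1 ≤ |y| := by
        rw [hy, abs_mul, abs_of_pos (a := r' * _) (by positivity), ← mul_assoc, mul_one_div,
          le_div_iff₀ (by positivity)]
        calc exp 1 * ((j : ℝ) + 1) ^ γ'⁻¹ ≤ exp 1 * (κ * |t|) := by gcongr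
          _ = |t| * r' := by rw [hκ]; field_simp
      have hy0 : 0 < |y| := (exp_pos 1).trans_le hye
      have hsin : |sinc y| ≤ exp (-1) := by
        rw [sinc_of_ne_zero (abs_pos.1 hy0), abs_div, exp_neg, ← one_div]
        exact div_le_div₀ zero_le_one (abs_sin_le_one y) (exp_pos 1) hye
      calc sinc y ^ 2 = |sinc y| * |sinc y| := by rw [← sq, sq_abs]
        _ ≤ exp (-1) * 1 := by
          gcongr
          exact abs_sinc_le_one y
        _ = exp (-1) := mul_one _
    have hK : K * |t| ^ γ ≤ (κ * |t|) ^ γ' := by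
      calc K * |t| ^ γ ≤ κ ^ γ' * |t| ^ (γ' - γ) * |t| ^ γ := by gcongr
        _ = (κ * |t|) ^ γ' := by
          rw [mul_assoc, ← rpow_add ht0, sub_add_cancel, mul_rpow hκ0.le ht0.le]
    calc _ ≤ exp (-N) * exp (K * |t| ^ γ) := by gcongr
      _ = exp (-N + K * |t| ^ γ) := (exp_add _ _).symm
      _ ≤ exp 1 := by
        gcongr
        have := Nat.lt_floor_add_one ((κ * |t|) ^ γ')
        rw [← hN] at this
        linarith

theorem exists_norm_fourierCoeffOn_le {a b : ℝ} (hab : a < b) {f : ℝ → ℂ} (hf : Continuous f) :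
    ∃ D, ∀ n, ‖fourierCoeffOn hab f n‖ ≤ D := by
  obtain ⟨D, hD⟩ := (isCompact_Icc (a := a) (b := b)).exists_bound_of_continuousOn hf.continuousOn
  refine ⟨‖1 / (b - a)‖ * (D * |b - a|), fun n => ?_⟩
  rw [fourierCoeffOn_eq_integral, norm_smul]
  gcongr
  refine intervalIntegral.norm_integral_le_of_norm_le_const fun x hx => ?_
  rw [Set.uIoc_of_le hab.le] at hx
  rw [norm_smul, fourier_apply, Circle.norm_coe, one_mul]
  exact hD x ⟨hx.1.le, hx.2⟩

theorem summable_fourierCoeffOn {a b : ℝ} (hab : a < b) {f f' f'' : ℝ → ℂ}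
    (hf : ∀ x, HasDerivAt f (f' x) x) (hf' : ∀ x, HasDerivAt f' (f'' x) x) (hf'' : Continuous f'')
    (h : f a = f b) (h' : f' a = f' b) : Summable (fourierCoeffOn hab f) := by
  obtain ⟨D, hD⟩ := exists_norm_fourierCoeffOn_le hab hf''
  have hc' : Continuous f' := continuous_iff_continuousAt.2 fun x => (hf' x).continuousAt
  have hsum : Summable fun n : ℤ => ((b - a) / (2 * π)) ^ 2 * D * (1 / (n : ℝ) ^ 2) :=
    (Real.summable_one_div_int_pow.2 one_lt_two).mul_left _
  refine Summable.of_norm_bounded_eventually hsum ?_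
  filter_upwards [(Set.finite_singleton (0 : ℤ)).compl_mem_cofinite] with n hn
  have hn : n ≠ 0 := hn
  rw [fourierCoeffOn_of_hasDerivAt hab hn (fun x _ => hf x) (hc'.intervalIntegrable _ _),
    fourierCoeffOn_of_hasDerivAt hab hn (fun x _ => hf' x) (hf''.intervalIntegrable _ _),
    h, h', sub_self, sub_self, mul_zero, zero_sub, zero_sub]
  have hba : ‖(b : ℂ) - a‖ = b - a := by
    rw [← Complex.ofReal_sub, Complex.norm_real, Real.norm_of_nonneg (by linarith)]
  simp only [norm_mul, norm_neg, norm_div, norm_one, hba, Complex.norm_I, Complex.norm_real,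
    Complex.norm_intCast, Real.norm_of_nonneg pi_pos.le, Complex.norm_ofNat, mul_one]
  have hn' : 0 < |(n : ℝ)| := by positivity
  rw [← sq_abs (n : ℝ)]
  have h0 : 0 < b - a := by linarith
  calc _ = ((b - a) / (2 * π)) ^ 2 * (1 / |(n : ℝ)| ^ 2) * ‖fourierCoeffOn hab f'' n‖ := by
        field_simp
    _ ≤ ((b - a) / (2 * π)) ^ 2 * (1 / |(n : ℝ)| ^ 2) * D := by
        gcongr
        exact hD n
    _ = _ := by ring

theorem exists_trigSum_bump {L r : ℝ} (hr : 0 < r) (hrL : 2 * r < L) :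
    ∃ c : ℤ → ℂ, (Summable fun n => ‖c n‖) ∧ (∀ x, |x| ≤ r → trigSum (π / L) c x = 1) ∧
      ∀ x, 2 * r ≤ |x| → |x| < L → trigSum (π / L) c x = 0 := by
  let f : ContDiffBump (0 : ℝ) := ⟨r, 2 * r, hr, by linarith⟩
  have hL : 0 < L := by linarith
  have hT : Fact (0 < 2 * L) := ⟨by linarith⟩
  have hf : ContDiff ℝ 2 f := f.contDiff
  have hf1 : ContDiff ℝ 1 (deriv f) := hf.deriv'
  have hf2 : Continuous (deriv (deriv f)) := hf1.continuous_deriv le_rfl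
  have hz : ∀ x, 2 * r < |x| → f =ᶠ[𝓝 x] 0 := fun x hx =>
    eventually_of_mem ((isOpen_lt continuous_const continuous_abs).mem_nhds hx) fun y hy =>
      f.zero_of_le_dist (by simpa using (show 2 * r < |y| from hy).le)
  have hz' : ∀ x, 2 * r < |x| → deriv f x = 0 := fun x hx => by
    rw [(hz x hx).deriv_eq]; simp
  have habs : |(-L)| = L := by rw [abs_neg, abs_of_pos hL]
  have hbL : -L + 2 * L = L := by ring
  have e0 : f (-L) = 0 := (hz _ (by rw [habs]; exact hrL)).eq_of_nhds
  have e1 : f L = 0 := (hz _ (by rw [abs_of_pos hL]; exact hrL)).eq_of_nhds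
  have hlt : -L < -L + 2 * L := by linarith
  have hsum : Summable (fourierCoeffOn hlt fun x => (f x : ℂ)) := by
    refine summable_fourierCoeffOn hlt
      (fun x => ((hf.differentiable two_ne_zero) x).hasDerivAt.ofReal_comp)
      (fun x => ((hf1.differentiable one_ne_zero) x).hasDerivAt.ofReal_comp)
      (Complex.continuous_ofReal.comp hf2) ?_ ?_
    · rw [hbL, e0, e1]
    · rw [hbL, hz' _ (by rw [habs]; exact hrL), hz' _ (by rw [abs_of_pos hL]; exact hrL)]
  let F : C(AddCircle (2 * L), ℂ) := ⟨AddCircle.liftIco (2 * L) (-L) fun x => (f x : ℂ),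
    AddCircle.liftIco_continuous (by rw [hbL, e0, e1])
      (Complex.continuous_ofReal.comp f.continuous).continuousOn⟩
  have hcoeff : fourierCoeff F = fourierCoeffOn hlt fun x => (f x : ℂ) :=
    funext fun n => fourierCoeff_liftIco_eq _ n
  have key : ∀ x, |x| < L → trigSum (π / L) (fourierCoeffOn hlt fun x => (f x : ℂ)) x = f x := by
    intro x hx
    have := (has_pointwise_sum_fourier_series_of_summable (f := F) (by rwa [hcoeff])
      (x : AddCircle (2 * L))).tsum_eq
    have hFx : F (x : AddCircle (2 * L)) = f x :=
      AddCircle.liftIco_coe_apply (f := fun x => (f x : ℂ))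
        ⟨(abs_lt.1 hx).1.le, by rw [hbL]; exact (abs_lt.1 hx).2⟩
    rw [hFx, hcoeff] at this
    rw [← this, trigSum]
    refine tsum_congr fun n => ?_
    rw [smul_eq_mul, fourier_coe_apply]
    congr 2
    have : (L : ℂ) ≠ 0 := by exact_mod_cast hL.ne'
    push_cast
    field_simp
  refine ⟨_, hsum.norm, fun x hx => ?_, fun x hx hxL => ?_⟩
  · rw [key x (by linarith), f.one_of_mem_closedBall (by simpa using hx)]
    simp
  · rw [key x hxL, f.zero_of_le_dist (by simpa using hx)]
    simp

theorem tendsto_abs_mul_intCast_cofinite {θ : ℝ} (hθ : 0 < θ) :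
    Tendsto (fun n : ℤ => |θ * n|) cofinite atTop := by
  simp_rw [abs_mul, abs_of_pos hθ]
  exact ((tendsto_norm_cocompact_atTop (E := ℝ)).comp Int.tendsto_coe_cofinite).const_mul_atTop hθ

theorem exists_trigSum_bump_summable_exp {L r γ : ℝ} (hr : 0 < r) (hrL : 2 * r < L) (hγ : 0 < γ)
    (hγ1 : γ < 1) (K : ℝ) :
    ∃ c : ℤ → ℂ, (Summable fun n : ℤ => ‖c n‖ * exp (K * |π / L * n| ^ γ)) ∧
      trigSum (π / L) c 0 = 1 ∧ ∀ x, 3 * r ≤ |x| → |x| + r < L → trigSum (π / L) c x = 0 := by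
  obtain ⟨c, hc, hc1, hc0⟩ := exists_trigSum_bump hr hrL
  obtain ⟨ε, hε, hεr, t₀, ht₀⟩ := sincProdLim_le_exp hγ hγ1 hr K
  refine ⟨fun n => c n * sincProdLim ε (π / L * n), ?_, ?_, fun x hx hxL => ?_⟩
  · refine Summable.of_norm_bounded_eventually (hc.mul_right (exp 1)) ?_
    have hpos : 0 < π / L := div_pos pi_pos (by linarith)
    filter_upwards [(tendsto_abs_mul_intCast_cofinite hpos).eventually_ge_atTop t₀] with n hn
    rw [norm_mul, norm_norm, norm_mul, Complex.norm_real, Real.norm_of_nonneg (exp_pos _).le,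
      Real.norm_of_nonneg (sincProdLim_nonneg _ _), mul_assoc]
    exact mul_le_mul_of_nonneg_left (ht₀ _ hn) (norm_nonneg _)
  · exact trigSum_sincProdLim_eq hε hεr hc fun y hy => hc1 y (by simpa using hy)
  · refine trigSum_sincProdLim_eq hε hεr hc fun y hy => hc0 y ?_ ?_
    · have := abs_sub_abs_le_abs_sub x y
      rw [abs_sub_comm] at this
      linarith
    · have := abs_sub_abs_le_abs_sub y x
      linarith

section Growth

variable {S B : Type*} [NormedRing S] [NormedAlgebra ℂ S] [CompleteSpace S] [CStarAlgebra B]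

theorem norm_map_exp_le_one (j : S →ₐ[ℂ] B) (hj : Continuous j) {a : S}
    (ha : IsSelfAdjoint (j a)) (t : ℝ) :
    ‖j (NormedSpace.exp ((t * Complex.I : ℂ) • a))‖ ≤ 1 := by
  let _ := NormedAlgebra.restrictScalars ℚ ℂ S
  let _ := NormedAlgebra.restrictScalars ℚ ℂ B
  rw [NormedSpace.map_exp j hj, map_smul]
  have hskew : (t * Complex.I : ℂ) • j a ∈ skewAdjoint B := by
    rw [skewAdjoint.mem_iff, star_smul, ha.star_eq]
    simp
  rcases subsingleton_or_nontrivial B with hB | hB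
  · rw [Subsingleton.elim (NormedSpace.exp _) (0 : B), norm_zero]
    exact zero_le_one
  · exact (CStarRing.norm_of_mem_unitary
      (NormedSpace.exp_mem_unitary_of_mem_skewAdjoint hskew)).le

theorem exists_norm_exp_le (j : S →ₐ[ℂ] B) (hj : Continuous j)
    {k : ℕ} (hk : 2 ≤ k) {p q : ℝ} (hp : 0 < p) (hq : 0 < q) (hpq : p + q = k) {C : ℝ}
    (hC : 0 < C) (hdiff : ∀ s : S, ‖s ^ k‖ ≤ C * ‖s‖ ^ p * ‖j s‖ ^ q) {a : S}
    (ha : IsSelfAdjoint (j a)) :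
    ∃ γ K : ℝ, 0 < γ ∧ γ < 1 ∧ ∀ t : ℝ, 1 ≤ |t| →
      ‖NormedSpace.exp ((t * Complex.I : ℂ) • a)‖ ≤ exp (K * |t| ^ γ) := by
  let _ := NormedAlgebra.restrictScalars ℚ ℂ S
  have hk' : (2 : ℝ) ≤ k := by exact_mod_cast hk
  obtain ⟨P, hP, hPk⟩ := exists_between
    (show max p 1 < (k : ℝ) from max_lt (by linarith) (by linarith))
  have hpP : p ≤ P := (le_max_left _ _).trans hP.le
  have hP1 : 1 < P := (le_max_right _ _).trans_lt hP
  set U : ℝ → S := fun t => NormedSpace.exp ((t * Complex.I : ℂ) • a) with hU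
  have hUc : Continuous U := NormedSpace.exp_continuous.comp (by fun_prop)
  have hUk : ∀ t, U (k * t) = U t ^ k := fun t => by
    rw [hU]
    simp only
    rw [← NormedSpace.exp_nsmul, ← Nat.cast_smul_eq_nsmul ℂ, smul_smul]
    push_cast
    ring_nf
  set g : ℝ → ℝ := fun t => max ‖U t‖ 1 with hg
  have hg1 : ∀ t, 1 ≤ g t := fun t => le_max_right _ _
  have hgk : ∀ t, g (k * t) ≤ max C 1 * g t ^ P := fun t => by
    refine max_le ?_ ?_
    · rw [hUk]
      calc ‖U t ^ k‖ ≤ C * ‖U t‖ ^ p * ‖j (U t)‖ ^ q := hdiff _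
        _ ≤ max C 1 * g t ^ P * 1 := by
          gcongr
          · exact le_max_left _ _
          · calc ‖U t‖ ^ p ≤ g t ^ p := by
                  gcongr
                  exact le_max_left _ _
              _ ≤ g t ^ P := rpow_le_rpow_of_exponent_le (hg1 t) hpP
          · exact rpow_le_one (norm_nonneg _) (norm_map_exp_le_one j hj ha t) hq.le
        _ = _ := mul_one _
    · exact one_le_mul_of_one_le_of_one_le (le_max_right _ _) (one_le_rpow (hg1 t) (by linarith))
  set d := log (max C 1) / (P - 1) with hd
  have hd0 : 0 ≤ d := div_nonneg (log_nonneg (le_max_right _ _)) (by linarith)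
  set h : ℝ → ℝ := fun t => log (g t) + d with hh
  have hhk : ∀ t, h (k * t) ≤ P * h t := fun t => by
    have hgt : 0 < g t := by linarith [hg1 t]
    have h1 := log_le_log (by linarith [hg1 (k * t)]) (hgk t)
    rw [log_mul (by positivity) (by positivity), log_rpow hgt] at h1
    have h2 : log (max C 1) = d * (P - 1) := by
      rw [hd, div_mul_cancel₀]
      linarith
    simp only [hh]
    linarith
  have hgc : Continuous g := hUc.norm.max continuous_const
  have hhc : Continuous h := (hgc.log fun t => by linarith [hg1 t]).add continuous_const
  obtain ⟨H, hH⟩ := (isCompact_Icc (a := -(k : ℝ)) (b := k)).exists_bound_of_continuousOn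
    hhc.continuousOn
  have hH0 : 0 ≤ H := (norm_nonneg _).trans (hH 0 ⟨by linarith, by linarith⟩)
  set γ := logb k P with hγ
  have hγ0 : 0 < γ := logb_pos (by linarith) hP1
  have hγ1 : γ < 1 := by
    rw [hγ, logb_lt_iff_lt_rpow (by linarith) (by linarith), rpow_one]
    exact hPk
  have hkγ : (k : ℝ) ^ γ = P := rpow_logb (by linarith) (by linarith) (by linarith)
  have main : ∀ N : ℕ, ∀ t : ℝ, 1 ≤ |t| → |t| ≤ (k : ℝ) ^ (N + 1) → h t ≤ H * |t| ^ γ := by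
    intro N
    induction N with
    | zero =>
      intro t ht1 ht
      rw [zero_add, pow_one] at ht
      calc h t ≤ H := (le_abs_self _).trans (hH t (abs_le.1 ht))
        _ ≤ H * |t| ^ γ := le_mul_of_one_le_right hH0 (one_le_rpow ht1 hγ0.le)
    | succ N ih =>
      intro t ht1 ht
      rcases le_total |t| k with htk | htk
      · calc h t ≤ H := (le_abs_self _).trans (hH t (abs_le.1 htk))
          _ ≤ H * |t| ^ γ := le_mul_of_one_le_right hH0 (one_le_rpow ht1 hγ0.le)
      · have hk0 : (0 : ℝ) < k := by linarith
        have habs : |t / k| = |t| / k := by rw [abs_div, abs_of_pos hk0]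
        have h1 := ih (t / k) (by rw [habs, le_div_iff₀ hk0]; linarith)
          (by rw [habs, div_le_iff₀ hk0, ← pow_succ]; exact ht)
        calc h t = h (k * (t / k)) := by rw [mul_div_cancel₀ _ hk0.ne']
          _ ≤ P * h (t / k) := hhk _
          _ ≤ P * (H * |t / k| ^ γ) := by gcongr
          _ = H * |t| ^ γ := by
            rw [habs, div_rpow (abs_nonneg _) hk0.le, hkγ]
            field_simp
  refine ⟨γ, H, hγ0, hγ1, fun t ht => ?_⟩
  obtain ⟨N, hN⟩ := pow_unbounded_of_one_lt |t| (show (1 : ℝ) < k by linarith)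
  have h1 := main N t ht (hN.le.trans (pow_le_pow_right₀ (by linarith) (Nat.le_succ N)))
  calc ‖U t‖ ≤ g t := le_max_left _ _
    _ = exp (log (g t)) := (exp_log (by linarith [hg1 t])).symm
    _ ≤ exp (H * |t| ^ γ) := by
      gcongr
      simp only [hh] at h1
      linarith

theorem character_exp (φ : WeakDual.characterSpace ℂ S) (x : S) :
    φ (NormedSpace.exp x) = Complex.exp (φ x) := by
  let _ := NormedAlgebra.restrictScalars ℚ ℂ S
  rw [NormedSpace.map_exp φ (map_continuous φ), Complex.exp_eq_exp_ℂ]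

theorem norm_character_apply_le (φ : WeakDual.characterSpace ℂ S) (x : S) :
    ‖φ x‖ ≤ ‖x‖ * ‖(1 : S)‖ :=
  spectrum.norm_le_norm_mul_of_mem (WeakDual.CharacterSpace.apply_mem_spectrum φ x)

theorem character_im_eq_zero (j : S →ₐ[ℂ] B) (hj : Continuous j)
    {k : ℕ} (hk : 2 ≤ k) {p q : ℝ} (hp : 0 < p) (hq : 0 < q) (hpq : p + q = k) {C : ℝ}
    (hC : 0 < C) (hdiff : ∀ s : S, ‖s ^ k‖ ≤ C * ‖s‖ ^ p * ‖j s‖ ^ q) {a : S}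
    (ha : IsSelfAdjoint (j a)) (φ : WeakDual.characterSpace ℂ S) : (φ a).im = 0 := by
  obtain ⟨γ, K, hγ, hγ1, hK⟩ := exists_norm_exp_le j hj hk hp hq hpq hC hdiff ha
  by_contra hne
  set y := (φ a).im with hy
  have hbound : ∀ t : ℝ, 1 ≤ |t| → exp (-(t * y)) ≤ exp (K * |t| ^ γ) * ‖(1 : S)‖ := by
    intro t ht
    have h1 := norm_character_apply_le φ (NormedSpace.exp ((t * Complex.I : ℂ) • a))
    rw [character_exp, map_smul, Complex.norm_exp] at h1
    have h2 : ((t * Complex.I : ℂ) • φ a).re = -(t * y) := by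
      simp [hy]
    rw [h2] at h1
    exact h1.trans (by gcongr; exact hK t ht)
  have hev : ∀ᶠ s : ℝ in atTop, K * s ^ γ + (‖(1 : S)‖) < s * |y| := by
    have hy0 : 0 < |y| := abs_pos.2 hne
    have h1 : Tendsto (fun s : ℝ => s * (|y| - K * s ^ (γ - 1))) atTop atTop := by
      refine tendsto_id.atTop_mul_pos hy0 ?_
      have := (tendsto_rpow_neg_atTop (show 0 < 1 - γ by linarith)).const_mul K
      simpa using this.const_sub |y|
    filter_upwards [h1.eventually_gt_atTop ‖(1 : S)‖, eventually_gt_atTop 0] with s hs hs0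
    have : s * s ^ (γ - 1) = s ^ γ := by
      rw [mul_comm, rpow_sub_one hs0.ne', div_mul_cancel₀ _ hs0.ne']
    rw [← this]
    linarith
  obtain ⟨s, hs, hs1⟩ := (hev.and (eventually_ge_atTop 1)).exists
  have hs0 : 0 < s := by linarith
  have habs : |s * SignType.sign (-y)| = s := by
    rw [abs_mul, abs_of_pos hs0]
    rcases lt_or_gt_of_ne hne with h | h <;> simp [h]
  have h1 := hbound (s * SignType.sign (-y)) (by rw [habs]; exact hs1)
  rw [habs, ← mul_neg_one, mul_assoc, mul_assoc, mul_neg_one, sign_mul_self, abs_neg] at h1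
  have h2 : exp (K * s ^ γ) * ‖(1 : S)‖ < exp (s * |y|) := by
    calc exp (K * s ^ γ) * ‖(1 : S)‖ < exp (K * s ^ γ) * exp ‖(1 : S)‖ := by
          gcongr
          linarith [add_one_le_exp ‖(1 : S)‖]
      _ = exp (K * s ^ γ + ‖(1 : S)‖) := (exp_add _ _).symm
      _ ≤ exp (s * |y|) := exp_le_exp.2 hs.le
  linarith

theorem exists_character_bump (j : S →ₐ[ℂ] B) (hj : Continuous j)
    {k : ℕ} (hk : 2 ≤ k) {p q : ℝ} (hp : 0 < p) (hq : 0 < q) (hpq : p + q = k) {C : ℝ}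
    (hC : 0 < C) (hdiff : ∀ s : S, ‖s ^ k‖ ≤ C * ‖s‖ ^ p * ‖j s‖ ^ q) {a : S}
    (ha : IsSelfAdjoint (j a)) {r : ℝ} (hr : 0 < r) :
    ∃ b : S, (∀ φ : WeakDual.characterSpace ℂ S, φ a = 0 → φ b = 1) ∧
      ∀ φ : WeakDual.characterSpace ℂ S, r ≤ ‖φ a‖ → φ b = 0 := by
  obtain ⟨γ, K, hγ, hγ1, hK⟩ := exists_norm_exp_le j hj hk hp hq hpq hC hdiff ha
  set M := ‖a‖ * ‖(1 : S)‖ with hM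
  have hM0 : 0 ≤ M := by positivity
  have hρ0 : 0 < min r 1 / 3 := by positivity
  have hρ1 : min r 1 ≤ 1 := min_le_right _ _
  obtain ⟨c, hc, hc1, hc0⟩ := exists_trigSum_bump_summable_exp (L := M + 2) hρ0
    (by linarith) hγ hγ1 K
  set θ := π / (M + 2) with hθ
  have hθ0 : 0 < θ := by positivity
  have hsum : Summable fun n : ℤ => c n • NormedSpace.exp (((θ * n : ℝ) * Complex.I : ℂ) • a) := by
    refine Summable.of_norm_bounded_eventually hc ?_
    filter_upwards [(tendsto_abs_mul_intCast_cofinite hθ0).eventually_ge_atTop 1] with n hn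
    rw [norm_smul]
    gcongr
    exact hK _ hn
  have hφ : ∀ φ : WeakDual.characterSpace ℂ S,
      φ (∑' n : ℤ, c n • NormedSpace.exp (((θ * n : ℝ) * Complex.I : ℂ) • a)) =
        trigSum θ c (φ a).re := by
    intro φ
    have him := character_im_eq_zero j hj hk hp hq hpq hC hdiff ha φ
    rw [hsum.map_tsum φ (map_continuous φ), trigSum]
    refine tsum_congr fun n => ?_
    rw [map_smul, character_exp, map_smul, smul_eq_mul, smul_eq_mul]
    congr 2
    conv_lhs => rw [← Complex.re_add_im (φ a), him]
    push_cast
    ring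
  refine ⟨∑' n : ℤ, c n • NormedSpace.exp (((θ * n : ℝ) * Complex.I : ℂ) • a),
    fun φ h => ?_, fun φ h => ?_⟩
  · rw [hφ, h, Complex.zero_re, hc1]
  · have him := character_im_eq_zero j hj hk hp hq hpq hC hdiff ha φ
    have habs : ‖φ a‖ = |(φ a).re| := by
      conv_lhs => rw [← Complex.re_add_im (φ a), him]
      simp
    have hle := norm_character_apply_le φ a
    rw [habs] at h hle
    rw [hφ]
    exact hc0 _ (by linarith [min_le_left r 1]) (by linarith)

end Growth

/-- A character of the closed subalgebra generated by `a` is determined by its value at `a`. -/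
theorem character_ext_of_adjoin {A : Type*} [NormedRing A] [NormedAlgebra ℂ A] (a : A)
    {φ ψ : WeakDual.characterSpace ℂ (Algebra.adjoin ℂ {a}).topologicalClosure}
    (h : φ ⟨a, Subalgebra.le_topologicalClosure _ (Algebra.self_mem_adjoin_singleton ℂ a)⟩ =
      ψ ⟨a, Subalgebra.le_topologicalClosure _ (Algebra.self_mem_adjoin_singleton ℂ a)⟩) :
    φ = ψ := by
  let S := (Algebra.adjoin ℂ {a}).topologicalClosure
  have hle : Algebra.adjoin ℂ {a} ≤ S := Subalgebra.le_topologicalClosure _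
  let E : Subalgebra ℂ S := AlgHom.equalizer
    (WeakDual.CharacterSpace.toAlgHom φ) (WeakDual.CharacterSpace.toAlgHom ψ)
  have hadj : ∀ x (hx : x ∈ Algebra.adjoin ℂ {a}), φ ⟨x, hle hx⟩ = ψ ⟨x, hle hx⟩ := by
    intro x hx
    have : Algebra.adjoin ℂ {a} ≤ E.map S.val := by
      refine Algebra.adjoin_le ?_
      rw [Set.singleton_subset_iff]
      exact ⟨⟨a, _⟩, h, rfl⟩
    obtain ⟨⟨y, hyS⟩, hy, rfl⟩ := this hx
    exact hy
  ext x
  have hcl : IsClosed {x : S | φ x = ψ x} := isClosed_eq (map_continuous φ) (map_continuous ψ)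
  have hdense : Dense {x : S | (x : A) ∈ Algebra.adjoin ℂ {a}} := by
    intro x
    rw [closure_subtype]
    refine closure_mono ?_ x.2
    intro y hy
    exact ⟨⟨y, hle hy⟩, hy, rfl⟩
  have hsub : {x : S | (x : A) ∈ Algebra.adjoin ℂ {a}} ⊆ {x : S | φ x = ψ x} :=
    fun y hy => hadj y hy
  exact closure_minimal hsub hcl (hdense x)

/-- Local regularity: in a unital `(k,p,q)`-differential subalgebra,
for every self-adjoint `a ∈ A` the closed unital subalgebra `S` generated by `a` is a
regular commutative Banach algebra: its Gelfand transform separates points of the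
character space from closed sets. -/
theorem stmt7
    {A B : Type*}
    [NormedRing A] [StarRing A] [NormedAlgebra ℂ A] [CompleteSpace A]
    [CStarAlgebra B]
    (hstar : Continuous (star : A → A))
    (ι : A →⋆ₐ[ℂ] B) (hinj : Function.Injective ι) (hcont : Continuous ι)
    (k : ℕ) (hk : 2 ≤ k) (p q : ℝ) (hp : 0 < p) (hq : 0 < q) (hpq : p + q = (k : ℝ))
    (C : ℝ) (hC : 0 < C)
    (hdiff : ∀ a : A, ‖a ^ k‖ ≤ C * ‖a‖ ^ p * ‖ι a‖ ^ q)
    (a : A) (ha : star a = a) :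
    ∀ X : Set (WeakDual.characterSpace ℂ ((Algebra.adjoin ℂ {a}).topologicalClosure)),
      IsClosed X →
      ∀ ω : WeakDual.characterSpace ℂ ((Algebra.adjoin ℂ {a}).topologicalClosure),
        ω ∉ X →
        ∃ b : (Algebra.adjoin ℂ {a}).topologicalClosure,
          (∀ φ ∈ X, φ b = 0) ∧ ω b ≠ 0 := by
  intro X hX ω hω
  let S := (Algebra.adjoin ℂ {a}).topologicalClosure
  have : CompleteSpace S :=
    (Subalgebra.isClosed_topologicalClosure (Algebra.adjoin ℂ {a})).completeSpace_coe
  let x : S := ⟨a, Subalgebra.le_topologicalClosure _ (Algebra.self_mem_adjoin_singleton ℂ a)⟩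
  let j : S →ₐ[ℂ] B := (ι : A →ₐ[ℂ] B).comp S.val
  have hj : Continuous j := hcont.comp continuous_subtype_val
  have hdiff' : ∀ s : S, ‖s ^ k‖ ≤ C * ‖s‖ ^ p * ‖j s‖ ^ q := fun s => hdiff s
  have hx : IsSelfAdjoint (j x) := by
    change star (ι a) = ι a
    rw [← map_star, ha]
  have hω_im := character_im_eq_zero j hj hk hp hq hpq hC hdiff' hx ω
  have hω_re : ω x = ((ω x).re : ℂ) := Complex.ext rfl (by simpa using hω_im)
  have hx' : IsSelfAdjoint (j (x - algebraMap ℂ S (ω x))) := by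
    rw [map_sub, AlgHom.commutes, hω_re]
    refine hx.sub ?_
    rw [IsSelfAdjoint, ← algebraMap_star_comm]
    simp
  have hXc : IsCompact ((fun φ : WeakDual.characterSpace ℂ S => φ x) '' X) :=
    hX.isCompact.image ((WeakDual.eval_continuous x).comp continuous_subtype_val)
  have hnot : ω x ∈ ((fun φ : WeakDual.characterSpace ℂ S => φ x) '' X)ᶜ := by
    rintro ⟨φ, hφX, hφ⟩
    exact hω (character_ext_of_adjoin a hφ ▸ hφX)
  obtain ⟨r, hr, hball⟩ := Metric.isOpen_iff.1 hXc.isClosed.isOpen_compl _ hnot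
  obtain ⟨b, hb1, hb0⟩ := exists_character_bump j hj hk hp hq hpq hC hdiff' hx' hr
  have happ : ∀ φ : WeakDual.characterSpace ℂ S, φ (x - algebraMap ℂ S (ω x)) = φ x - ω x :=
    fun φ => by rw [map_sub, AlgHomClass.commutes]; rfl
  refine ⟨b, fun φ hφ => hb0 φ ?_, ?_⟩
  · rw [happ]
    by_contra! hlt
    exact hball (by rwa [Metric.mem_ball, dist_eq_norm]) ⟨φ, hφ, rfl⟩
  · rw [hb1 ω (by rw [happ, sub_self])]
    exact one_ne_zero
end

section
/- Suppose the (k,p,q)-differential condition holds. Then A admits a unique C*-norm, namely a ↦ ‖ι(a)‖_B: if γ : A → ℝ satisfies γ(a) ≥ 0 with γ(a) = 0 if and only if a = 0, γ(λ·a) = |λ|·γ(a) for λ ∈ ℂ, γ(a + b) ≤ γ(a) + γ(b), γ(a·b) ≤ γ(a)·γ(b), and the C*-identity γ(a*·a) = γ(a)², then γ(a) = ‖ι(a)‖_B for every a ∈ A. -/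
open Filter Topology

universe u

theorem exists_le_mul_rpow_of_le_add_mul_div {L : ℕ → ℝ} {k : ℕ} (hk : 2 ≤ k) {p E s : ℝ}
    (hp : 0 < p) (hE : 0 ≤ E) (hL0 : 0 ≤ L 0) (hs : 0 < s) (hps : p < (k : ℝ) ^ s)
    (hL : ∀ n, L n ≤ E + p * L (n / k)) :
    ∃ K : ℝ, ∀ n, 1 ≤ n → L n ≤ K * (n : ℝ) ^ s := by
  have hk0 : (0 : ℝ) < k := by positivity
  have hks : 0 < (k : ℝ) ^ s := hp.trans hps
  have hratio : 0 < 1 - p / (k : ℝ) ^ s := by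
    rw [sub_pos, div_lt_one hks]; exact hps
  set K : ℝ := E + p * L 0 + E / (1 - p / (k : ℝ) ^ s) with hK
  have hpL : 0 ≤ p * L 0 := by positivity
  have hEr : 0 ≤ E / (1 - p / (k : ℝ) ^ s) := by positivity
  have hK1 : E + p * L 0 ≤ K := by linarith
  have hK2 : E ≤ K * (1 - p / (k : ℝ) ^ s) := by
    rw [← div_le_iff₀ hratio]; linarith
  have hK0 : 0 ≤ K := by linarith
  refine ⟨K, fun n => ?_⟩
  induction n using Nat.strong_induction_on with
  | _ n ih =>
    intro hn
    have hns : 1 ≤ (n : ℝ) ^ s := Real.one_le_rpow (by exact_mod_cast hn) hs.le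
    rcases lt_or_ge n k with h | h
    · have := hL n
      rw [Nat.div_eq_of_lt h] at this
      nlinarith
    · have h1 : 1 ≤ n / k := Nat.div_pos h (by lia)
      have h2 := ih (n / k) (Nat.div_lt_self (by lia) hk) h1
      have h3 : ((n / k : ℕ) : ℝ) ^ s ≤ (n : ℝ) ^ s / (k : ℝ) ^ s := by
        rw [← Real.div_rpow (by positivity) hk0.le]
        exact Real.rpow_le_rpow (by positivity) Nat.cast_div_le hs.le
      calc L n ≤ E + p * L (n / k) := hL n
        _ ≤ E + p * (K * ((n : ℝ) ^ s / (k : ℝ) ^ s)) := by gcongr; exact h2.trans (by gcongr)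
        _ ≤ K * (1 - p / (k : ℝ) ^ s) * (n : ℝ) ^ s + p * (K * ((n : ℝ) ^ s / (k : ℝ) ^ s)) := by
          gcongr
          exact hK2.trans (le_mul_of_one_le_right (by positivity) hns)
        _ = K * (n : ℝ) ^ s := by ring

theorem exists_lt_natCast_rpow {k : ℕ} (hk : 2 ≤ k) {p : ℝ} (hpk : p < k) :
    ∃ s : ℝ, 0 < s ∧ s < 1 ∧ p < (k : ℝ) ^ s := by
  have hk0 : (k : ℝ) ≠ 0 := by positivity
  have hcont : Tendsto (fun s : ℝ => (k : ℝ) ^ s) (𝓝[<] 1) (𝓝 (k : ℝ)) := by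
    have := (Real.continuous_const_rpow hk0).tendsto 1
    rw [Real.rpow_one] at this
    exact this.mono_left nhdsWithin_le_nhds
  have h1 := hcont.eventually (lt_mem_nhds hpk)
  have h2 : ∀ᶠ s : ℝ in 𝓝[<] 1, s ∈ Set.Ioo (0 : ℝ) 1 := Ioo_mem_nhdsLT one_pos
  obtain ⟨s, h, h'⟩ := (h1.and h2).exists
  exact ⟨s, h'.1, h'.2, h⟩

/-- A Fourier cosine series that vanishes on `[a, 1 - a]`, from the second difference of the
Bernoulli polynomial of degree two. -/
theorem hasSum_sin_sq_div_sq_mul_cos {a : ℝ} (ha : 0 ≤ a) {x : ℝ} (hx : x ∈ Set.Icc a (1 - a)) :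
    HasSum (fun n : ℕ => (if n = 0 then 2 * Real.pi ^ 2 * a ^ 2 else
      4 * Real.sin (Real.pi * n * a) ^ 2 / (n : ℝ) ^ 2) * Real.cos (2 * Real.pi * n * x)) 0 := by
  have hB : ∀ y ∈ Set.Icc (0 : ℝ) 1,
      HasSum (fun n : ℕ => 1 / (n : ℝ) ^ 2 * Real.cos (2 * Real.pi * n * y))
        (Real.pi ^ 2 * (y ^ 2 - y + 1 / 6)) := by
    intro y hy
    have := hasSum_one_div_nat_pow_mul_cos one_ne_zero hy
    convert! this using 1
    have hbern : Polynomial.aeval y (Polynomial.bernoulli 2) = y ^ 2 - y + 1 / 6 := by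
      simp [Polynomial.bernoulli, Finset.sum_range_succ, Polynomial.aeval_monomial,
        bernoulli_eq_bernoulli'_of_ne_one, bernoulli'_two]
      ring
    simp only [Polynomial.eval_map_algebraMap, mul_one, hbern, Nat.factorial_two]
    push_cast
    ring
  have h1 := hB (x + a) ⟨by linarith [hx.1], by linarith [hx.2]⟩
  have h2 := hB (x - a) ⟨by linarith [hx.1], by linarith [hx.2]⟩
  have h3 := hB x ⟨by linarith [hx.1], by linarith [hx.2]⟩
  have h4 : HasSum (fun n : ℕ => if n = 0 then 2 * Real.pi ^ 2 * a ^ 2 else 0)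
      (2 * Real.pi ^ 2 * a ^ 2) := hasSum_ite_eq 0 _
  convert! (((h3.mul_left 2).sub h1).sub h2).add h4 using 1
  · ext n
    rcases eq_or_ne n 0 with rfl | hn
    · simp
    · have e1 : 2 * Real.pi * n * (x + a) = 2 * Real.pi * n * x + 2 * (Real.pi * n * a) := by ring
      have e2 : 2 * Real.pi * n * (x - a) = 2 * Real.pi * n * x - 2 * (Real.pi * n * a) := by ring
      rw [if_neg hn, if_neg hn, e1, e2, Real.cos_add, Real.cos_sub,
        Real.cos_two_mul (Real.pi * n * a), Real.cos_sq']
      ring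
  · ring

theorem Real.abs_sinc_le_inv_abs {x : ℝ} (hx : x ≠ 0) : |Real.sinc x| ≤ |x|⁻¹ := by
  rw [Real.sinc_of_ne_zero hx, abs_div, div_eq_mul_inv]
  exact mul_le_of_le_one_left (by positivity) (Real.abs_sin_le_one x)

theorem integral_cos_mul_eq_sinc (w x a : ℝ) :
    ∫ t in (x - a)..(x + a), Real.cos (w * t) = 2 * a * (Real.sinc (w * a) * Real.cos (w * x)) := by
  rcases eq_or_ne w 0 with rfl | hw
  · simp; ring
  rcases eq_or_ne a 0 with rfl | ha
  · simp
  rw [intervalIntegral.integral_comp_mul_left (f := Real.cos) hw, integral_cos,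
    Real.sinc_of_ne_zero (mul_ne_zero hw ha), mul_add, mul_sub, Real.sin_add, Real.sin_sub, smul_eq_mul]
  field_simp
  ring

/-- Averaging a cosine series over `[x - a, x + a]` multiplies the coefficients by a `sinc` and
shrinks an interval on which the sum vanishes by `a` on both sides. -/
theorem hasSum_mul_sinc_mul_cos {c : ℕ → ℝ} (hc : Summable fun n => |c n|) {η a : ℝ} (ha : 0 < a)
    (h : ∀ x ∈ Set.Icc η (1 - η), HasSum (fun n : ℕ => c n * Real.cos (2 * Real.pi * n * x)) 0)
    {x : ℝ} (hx : x ∈ Set.Icc (η + a) (1 - (η + a))) :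
    HasSum (fun n : ℕ => c n * Real.sinc (2 * Real.pi * n * a) *
      Real.cos (2 * Real.pi * n * x)) 0 := by
  have key := intervalIntegral.hasSum_integral_of_dominated_convergence
    (μ := MeasureTheory.volume) (a := x - a) (b := x + a)
    (F := fun (n : ℕ) t => c n * Real.cos (2 * Real.pi * n * t)) (f := fun _ => (0 : ℝ))
    (fun n _ => |c n|)
    (fun n => (by fun_prop : Continuous _).aestronglyMeasurable)
    (fun n => Eventually.of_forall fun t _ => by
      rw [Real.norm_eq_abs, abs_mul]
      exact mul_le_of_le_one_right (abs_nonneg _) (Real.abs_cos_le_one _))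
    (Eventually.of_forall fun t _ => hc) (by simp)
    (Eventually.of_forall fun t ht => by
      rw [Set.uIoc_of_le (by linarith)] at ht
      exact h t ⟨by linarith [hx.1, ht.1], by linarith [hx.2, ht.2]⟩)
  simp only [intervalIntegral.integral_const_mul, integral_cos_mul_eq_sinc,
    intervalIntegral.integral_zero] at key
  convert! key.mul_left (2 * a)⁻¹ using 1
  · ext n; field_simp
  · simp

/-- Coefficients obtained from `b` by `N` double averagings. -/
theorem hasSum_mul_prod_sinc_sq_mul_cos {b : ℕ → ℝ} (hb : Summable fun n => |b n|) {η : ℝ}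
    (h : ∀ x ∈ Set.Icc η (1 - η), HasSum (fun n : ℕ => b n * Real.cos (2 * Real.pi * n * x)) 0)
    {a : ℕ → ℝ} (ha : ∀ j, 0 < a j) (N : ℕ) :
    ∀ x ∈ Set.Icc (η + 2 * ∑ j ∈ Finset.range N, a j) (1 - (η + 2 * ∑ j ∈ Finset.range N, a j)),
      HasSum (fun n : ℕ => b n * (∏ j ∈ Finset.range N, Real.sinc (2 * Real.pi * n * a j) ^ 2) *
        Real.cos (2 * Real.pi * n * x)) 0 := by
  induction N with
  | zero => simpa using h
  | succ N ih =>
    intro x hx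
    have hs : Summable fun n : ℕ =>
        |b n * ∏ j ∈ Finset.range N, Real.sinc (2 * Real.pi * n * a j) ^ 2| := by
      refine hb.of_nonneg_of_le (fun _ => abs_nonneg _) fun n => ?_
      rw [abs_mul, Finset.abs_prod]
      refine mul_le_of_le_one_right (abs_nonneg _)
        (Finset.prod_le_one (fun _ _ => abs_nonneg _) fun j _ => ?_)
      rw [abs_pow]
      exact pow_le_one₀ (abs_nonneg _) (Real.abs_sinc_le_one _)
    have hs' : Summable fun n : ℕ => |b n * (∏ j ∈ Finset.range N,
        Real.sinc (2 * Real.pi * n * a j) ^ 2) * Real.sinc (2 * Real.pi * n * a N)| := by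
      refine hs.of_nonneg_of_le (fun _ => abs_nonneg _) fun n => ?_
      rw [abs_mul _ (Real.sinc _)]
      exact mul_le_of_le_one_right (abs_nonneg _) (Real.abs_sinc_le_one _)
    rw [Finset.sum_range_succ] at hx
    have := hasSum_mul_sinc_mul_cos hs' (ha N) (fun y hy => hasSum_mul_sinc_mul_cos hs (ha N) ih hy)
      (x := x) ⟨by linarith [hx.1], by linarith [hx.2]⟩
    convert! this using 2 with n
    rw [Finset.prod_range_succ]
    ring

/-- The product of the first `⌊(κ n) ^ t⌋` factors `sinc (n β (j + 1) ^ (-1/t)) ^ 2` decays like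
`exp (-2 (κ n) ^ t)`, where `κ = β / e`. -/
theorem exists_prod_sinc_sq_le_exp {β t : ℝ} (hβ : 0 < β) (ht : 0 < t) (n : ℕ) :
    ∃ N : ℕ, ∏ j ∈ Finset.range N,
      Real.sinc (2 * Real.pi * n * (β * ((j + 1 : ℕ) : ℝ) ^ (-t⁻¹))) ^ 2 ≤
        Real.exp (2 - 2 * (2 * Real.pi * β / Real.exp 1 * n) ^ t) := by
  set y : ℝ := 2 * Real.pi * β / Real.exp 1 * n with hy
  have hy0 : 0 ≤ y := by positivity
  refine ⟨⌊y ^ t⌋₊, ?_⟩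
  have hfac : ∀ j ∈ Finset.range ⌊y ^ t⌋₊,
      Real.sinc (2 * Real.pi * n * (β * ((j + 1 : ℕ) : ℝ) ^ (-t⁻¹))) ^ 2 ≤ Real.exp (-2) := by
    intro j hj
    have hj' : ((j + 1 : ℕ) : ℝ) ≤ y ^ t :=
      (Nat.le_floor_iff (by positivity)).1 (Finset.mem_range.1 hj)
    have hjpos : (0 : ℝ) < ((j + 1 : ℕ) : ℝ) := by positivity
    have h1 : ((j + 1 : ℕ) : ℝ) ^ t⁻¹ ≤ y := by
      have := Real.rpow_le_rpow hjpos.le hj' (inv_pos.2 ht).le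
      rwa [← Real.rpow_mul hy0, mul_inv_cancel₀ ht.ne', Real.rpow_one] at this
    have hP : 0 < ((j + 1 : ℕ) : ℝ) ^ t⁻¹ := by positivity
    have h2 : Real.exp 1 ≤ 2 * Real.pi * n * (β * ((j + 1 : ℕ) : ℝ) ^ (-t⁻¹)) := by
      rw [Real.rpow_neg hjpos.le, ← div_eq_mul_inv, ← mul_div_assoc, le_div_iff₀ hP]
      calc Real.exp 1 * ((j + 1 : ℕ) : ℝ) ^ t⁻¹ ≤ Real.exp 1 * y := by gcongr
        _ = 2 * Real.pi * n * β := by rw [hy]; field_simp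
    have hpos := (Real.exp_pos 1).trans_le h2
    have h3 := Real.abs_sinc_le_inv_abs hpos.ne'
    rw [abs_of_pos hpos] at h3
    have h4 := h3.trans (inv_anti₀ (Real.exp_pos 1) h2)
    rw [← Real.exp_neg] at h4
    rw [← sq_abs]
    calc _ ≤ Real.exp (-1) ^ 2 := by gcongr
      _ = Real.exp (-2) := by rw [← Real.exp_nat_mul]; norm_num
  calc _ ≤ ∏ _j ∈ Finset.range ⌊y ^ t⌋₊, Real.exp (-2) :=
        Finset.prod_le_prod (fun _ _ => sq_nonneg _) hfac
    _ = Real.exp (⌊y ^ t⌋₊ * (-2)) := by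
        rw [Finset.prod_const, Finset.card_range, ← Real.exp_nat_mul]
    _ ≤ _ := by
        gcongr
        linarith [Nat.lt_floor_add_one (y ^ t)]

/-- Non-quasianalyticity of the weight `exp (K n ^ s)`, `s < 1`: there is a nonzero cosine series
whose coefficients are summable against this weight and whose sum vanishes on `[δ, 1 - δ]`. -/
theorem exists_hasSum_cos_eq_zero {s : ℝ} (hs0 : 0 < s) (hs : s < 1) (K : ℝ) {δ : ℝ} (hδ : 0 < δ) :
    ∃ c : ℕ → ℝ, (∀ n, 0 ≤ c n) ∧ 0 < c 0 ∧
      (Summable fun n : ℕ => c n * Real.exp (K * (n : ℝ) ^ s)) ∧ Summable c ∧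
      ∀ x ∈ Set.Icc δ (1 - δ), HasSum (fun n : ℕ => c n * Real.cos (2 * Real.pi * n * x)) 0 := by
  obtain ⟨t, hst, ht1⟩ := exists_between hs
  have ht0 : 0 < t := hs0.trans hst
  set b : ℕ → ℝ := fun n => if n = 0 then 2 * Real.pi ^ 2 * (δ / 2) ^ 2 else
      4 * Real.sin (Real.pi * n * (δ / 2)) ^ 2 / (n : ℝ) ^ 2 with hb
  have hb0 : ∀ n, 0 ≤ b n := fun n => by
    simp only [hb]; split_ifs <;> positivity
  have hbs : Summable b := by
    have h1 : Summable fun n : ℕ => 4 * (1 / (n : ℝ) ^ 2) :=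
      (Real.summable_one_div_nat_pow.2 one_lt_two).mul_left 4
    refine Summable.of_norm_bounded_eventually_nat h1 ?_
    filter_upwards [eventually_ne_atTop 0] with n hn
    rw [Real.norm_of_nonneg (hb0 n)]
    simp only [hb, if_neg hn]
    rw [mul_one_div]
    gcongr
    nlinarith [Real.sin_sq_le_one (Real.pi * n * (δ / 2))]
  have hsumm : Summable fun j : ℕ => ((j + 1 : ℕ) : ℝ) ^ (-t⁻¹) :=
    (summable_nat_add_iff 1).2 (Real.summable_nat_rpow.2 (neg_lt_neg ((one_lt_inv₀ ht0).2 ht1)))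
  set S : ℝ := ∑' j : ℕ, ((j + 1 : ℕ) : ℝ) ^ (-t⁻¹) with hS
  have hS0 : 0 ≤ S := tsum_nonneg fun _ => by positivity
  set β : ℝ := δ / 4 / (S + 1) with hβdef
  have hβ : 0 < β := by positivity
  set a : ℕ → ℝ := fun j => β * ((j + 1 : ℕ) : ℝ) ^ (-t⁻¹) with ha
  have ha0 : ∀ j, 0 < a j := fun j => by simp only [ha]; positivity
  have hasum : ∀ N, ∑ j ∈ Finset.range N, a j ≤ δ / 4 := fun N => by
    simp only [ha]
    rw [← Finset.mul_sum]
    calc _ ≤ β * (S + 1) := by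
          gcongr
          exact (hsumm.sum_le_tsum _ fun _ _ => by positivity).trans (by linarith)
      _ = δ / 4 := by rw [hβdef]; field_simp
  set P : ℕ → ℕ → ℝ := fun n N => ∏ j ∈ Finset.range N, Real.sinc (2 * Real.pi * n * a j) ^ 2 with hP
  have hP0 : ∀ n N, 0 ≤ P n N := fun n N => Finset.prod_nonneg fun _ _ => sq_nonneg _
  have hPanti : ∀ n, Antitone (P n) := fun n => antitone_nat_of_succ_le fun N => by
    simp only [hP]
    rw [Finset.prod_range_succ]
    refine mul_le_of_le_one_right (hP0 n N) ?_
    rw [← sq_abs]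
    exact pow_le_one₀ (abs_nonneg _) (Real.abs_sinc_le_one _)
  have hP1 : ∀ n N, P n N ≤ 1 := fun n N => by simpa [hP] using hPanti n (Nat.zero_le N)
  have hbdd : ∀ n, BddBelow (Set.range (P n)) := fun n => ⟨0, by rintro _ ⟨N, rfl⟩; exact hP0 n N⟩
  have hlim : ∀ n, Tendsto (P n) atTop (𝓝 (⨅ N, P n N)) :=
    fun n => tendsto_atTop_ciInf (hPanti n) (hbdd n)
  have hinf0 : ∀ n, 0 ≤ ⨅ N, P n N := fun n => le_ciInf (hP0 n)
  have hinf1 : ∀ n, ⨅ N, P n N ≤ 1 := fun n => (ciInf_le (hbdd n) 0).trans (hP1 n 0)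
  have hcs : Summable fun n => b n * ⨅ N, P n N :=
    hbs.of_nonneg_of_le (fun n => mul_nonneg (hb0 n) (hinf0 n))
      fun n => mul_le_of_le_one_right (hb0 n) (hinf1 n)
  refine ⟨fun n => b n * ⨅ N, P n N, fun n => mul_nonneg (hb0 n) (hinf0 n), ?_, ?_, hcs, ?_⟩
  · have : ∀ N, P 0 N = 1 := fun N => by simp [hP]
    simp only [this, ciInf_const, mul_one, hb, if_true]
    positivity
  · set κ : ℝ := 2 * Real.pi * β / Real.exp 1 with hκ
    have hκ0 : 0 < κ := by positivity
    refine Summable.of_norm_bounded_eventually_nat (hbs.mul_right (Real.exp 2)) ?_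
    have hlarge : ∀ᶠ n : ℕ in atTop, K / (2 * κ ^ t) ≤ (n : ℝ) ^ (t - s) :=
      ((tendsto_rpow_atTop (sub_pos.2 hst)).comp tendsto_natCast_atTop_atTop).eventually_ge_atTop _
    filter_upwards [hlarge, eventually_ge_atTop 1] with n hn hn1
    have hn0 : (0 : ℝ) < n := by exact_mod_cast hn1
    rw [Real.norm_of_nonneg (mul_nonneg (mul_nonneg (hb0 n) (hinf0 n)) (Real.exp_pos _).le), mul_assoc]
    refine mul_le_mul_of_nonneg_left ?_ (hb0 n)
    obtain ⟨N, hN⟩ := exists_prod_sinc_sq_le_exp hβ ht0 n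
    calc _ ≤ Real.exp (2 - 2 * (κ * n) ^ t) * Real.exp (K * (n : ℝ) ^ s) := by
          gcongr
          exact (ciInf_le (hbdd n) N).trans hN
      _ ≤ Real.exp 2 := by
          rw [← Real.exp_add]
          gcongr
          rw [div_le_iff₀ (by positivity), Real.rpow_sub hn0, div_mul_eq_mul_div,
            le_div_iff₀ (by positivity)] at hn
          rw [Real.mul_rpow hκ0.le hn0.le]
          linarith
  · intro x hx
    have hN : ∀ N, HasSum (fun n : ℕ => b n * P n N * Real.cos (2 * Real.pi * n * x)) 0 := fun N =>
      hasSum_mul_prod_sinc_sq_mul_cos (b := b) (η := δ / 2) (by simpa only [abs_of_nonneg (hb0 _)] using hbs)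
        (fun y hy => hasSum_sin_sq_div_sq_mul_cos (by positivity) hy) ha0 N x
        ⟨by linarith [hasum N, hx.1], by linarith [hasum N, hx.2]⟩
    have hbound : ∀ n : ℕ, ∀ r : ℝ, 0 ≤ r → r ≤ 1 →
        ‖b n * r * Real.cos (2 * Real.pi * n * x)‖ ≤ b n := fun n r hr hr1 => by
      rw [norm_mul, Real.norm_of_nonneg (mul_nonneg (hb0 n) hr), Real.norm_eq_abs]
      exact (mul_le_of_le_one_right (mul_nonneg (hb0 n) hr) (Real.abs_cos_le_one _)).trans
        (mul_le_of_le_one_right (hb0 n) hr1)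
    have hT := tendsto_tsum_of_dominated_convergence
      (f := fun (N : ℕ) (n : ℕ) => b n * P n N * Real.cos (2 * Real.pi * n * x))
      (g := fun n : ℕ => b n * (⨅ N, P n N) * Real.cos (2 * Real.pi * n * x)) (𝓕 := atTop) hbs
      (fun n => ((hlim n).const_mul _).mul_const _)
      (Eventually.of_forall fun N n => hbound n _ (hP0 n N) (hP1 n N))
    simp only [(hN _).tsum_eq] at hT
    have hsummable : Summable fun n : ℕ => b n * (⨅ N, P n N) * Real.cos (2 * Real.pi * n * x) :=
      Summable.of_norm_bounded hbs fun n => hbound n _ (hinf0 n) (hinf1 n)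
    rw [tendsto_nhds_unique tendsto_const_nhds hT]
    exact hsummable.hasSum

theorem isUnit_of_mul_isUnit_of_commute {R : Type*} [Ring R] {m z : R} (hcomm : Commute m z)
    (h : IsUnit (m * z)) : IsUnit m :=
  ((hcomm.isUnit_mul_iff).1 h).1

/-- `1 - u` divides `2 - u ^ n - v ^ n`, with a cofactor commuting with `u`, when `v` is the
inverse of `u`. -/
theorem exists_commute_mul_eq_two_sub_pow_sub_pow {R : Type*} [Ring R] {u v : R}
    (huv : u * v = 1) (hvu : v * u = 1) (n : ℕ) :
    ∃ z, Commute (1 - u) z ∧ (1 - u) * z = 2 - u ^ n - v ^ n := by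
  have hc : Commute u v := huv.trans hvu.symm
  have h1 : Commute (1 - u) (∑ i ∈ Finset.range n, u ^ i) :=
    Commute.sum_right _ _ _ fun i _ => ((Commute.one_left u).sub_left rfl).pow_right i
  have h2 : Commute (1 - u) (∑ i ∈ Finset.range n, v ^ i) :=
    Commute.sum_right _ _ _ fun i _ => ((Commute.one_left v).sub_left hc).pow_right i
  have h3 : Commute (1 - u) v := (Commute.one_left v).sub_left hc
  refine ⟨∑ i ∈ Finset.range n, u ^ i - v * ∑ i ∈ Finset.range n, v ^ i,
    h1.sub_right (h3.mul_right h2), ?_⟩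
  have e1 : (1 - u) * ∑ i ∈ Finset.range n, u ^ i = 1 - u ^ n := mul_neg_geom_sum u n
  have e2 : (1 - v) * ∑ i ∈ Finset.range n, v ^ i = 1 - v ^ n := mul_neg_geom_sum v n
  have e3 : (1 - u) * v = -(1 - v) := by rw [sub_mul, huv, one_mul]; abel
  rw [mul_sub, ← mul_assoc, e3, neg_mul, e1, e2]
  rw [← one_add_one_eq_two]
  abel

/-- A closed set of unit complex numbers not containing `1` is contained in an arc
`{exp (2 π i x) | δ ≤ x ≤ 1 - δ}`. -/
theorem exists_forall_mem_exists_exp_eq {S : Set ℂ} (hS : IsClosed S) (h1 : (1 : ℂ) ∉ S)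
    (hnorm : ∀ z ∈ S, ‖z‖ = 1) :
    ∃ δ > 0, ∀ z ∈ S, ∃ x ∈ Set.Icc δ (1 - δ),
      z = Complex.exp (((2 * Real.pi * x : ℝ) : ℂ) * Complex.I) := by
  have hcont : Continuous fun x : ℝ => Complex.exp (((2 * Real.pi * x : ℝ) : ℂ) * Complex.I) := by
    fun_prop
  have hev : ∀ᶠ x : ℝ in 𝓝 0, Complex.exp (((2 * Real.pi * x : ℝ) : ℂ) * Complex.I) ∉ S := by
    refine hcont.continuousAt.eventually_mem (hS.isOpen_compl.mem_nhds ?_)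
    simpa using h1
  obtain ⟨δ, hδ, hball⟩ := Metric.eventually_nhds_iff.1 hev
  have hper : ∀ (x : ℝ) (m : ℤ), Complex.exp (((2 * Real.pi * (x - m) : ℝ) : ℂ) * Complex.I) =
      Complex.exp (((2 * Real.pi * x : ℝ) : ℂ) * Complex.I) := fun x m => by
    rw [show ((2 * Real.pi * (x - m) : ℝ) : ℂ) * Complex.I =
      ((2 * Real.pi * x : ℝ) : ℂ) * Complex.I - m * (2 * Real.pi * Complex.I) by push_cast; ring]
    exact Complex.exp_periodic.sub_int_mul_eq m
  refine ⟨δ, hδ, fun z hz => ?_⟩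
  set x := Int.fract (z.arg / (2 * Real.pi)) with hx
  have hzx : z = Complex.exp (((2 * Real.pi * x : ℝ) : ℂ) * Complex.I) := by
    rw [hx, ← Int.self_sub_floor, hper, mul_div_cancel₀ _ (by positivity)]
    simpa [hnorm z hz] using (Complex.norm_mul_exp_arg_mul_I z).symm
  refine ⟨x, ⟨?_, ?_⟩, hzx⟩
  · by_contra! hlt
    refine hball (y := x) ?_ (hzx ▸ hz)
    rwa [Real.dist_eq, sub_zero, abs_of_nonneg (Int.fract_nonneg _)]
  · by_contra! hlt
    have h2 := hper x 1
    rw [← hzx] at h2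
    refine hball (y := x - (1 : ℤ)) ?_ (h2 ▸ hz)
    have h3 : x < 1 := Int.fract_lt_one _
    rw [Real.dist_eq, sub_zero, Int.cast_one, abs_of_nonpos (by linarith)]
    linarith

/-- If `u` is a unitary whose powers grow subexponentially, then an injective `*`-homomorphism
into a C⋆-algebra reflects invertibility of `1 - u`. -/
theorem isUnit_one_sub_of_isUnit_map {A D : Type*} [NormedRing A] [StarRing A] [NormedAlgebra ℂ A]
    [CompleteSpace A] [CStarAlgebra D] (φ : A →⋆ₐ[ℂ] D) (hinj : Function.Injective φ)
    (hcont : Continuous φ) {u : A} (hu : star u * u = 1) (hu' : u * star u = 1)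
    {s K : ℝ} (hs0 : 0 < s) (hs : s < 1)
    (hK : ∀ n : ℕ, 1 ≤ n → ‖u ^ n‖ ≤ Real.exp (K * (n : ℝ) ^ s))
    (hK' : ∀ n : ℕ, 1 ≤ n → ‖star u ^ n‖ ≤ Real.exp (K * (n : ℝ) ^ s))
    (hunit : IsUnit (1 - φ u)) : IsUnit (1 - u) := by
  have hφu : φ u ∈ unitary D := by
    rw [Unitary.mem_iff]
    exact ⟨by rw [← map_star, ← map_mul, hu, map_one], by rw [← map_star, ← map_mul, hu', map_one]⟩
  have hnorm : ∀ z ∈ spectrum ℂ (φ u), ‖z‖ = 1 := fun z hz => by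
    simpa using Unitary.spectrum_subset_circle (𝕜 := ℂ) ⟨φ u, hφu⟩ hz
  have h1 : (1 : ℂ) ∉ spectrum ℂ (φ u) := by
    rw [spectrum.notMem_iff, map_one]; exact hunit
  obtain ⟨δ, hδ, harc⟩ := exists_forall_mem_exists_exp_eq (spectrum.isClosed (φ u)) h1 hnorm
  obtain ⟨c, hc0, hc00, hcK, hcs, hcos⟩ := exists_hasSum_cos_eq_zero hs0 hs K hδ
  have hnormal : IsStarNormal (φ u) := ⟨hφu.1.trans hφu.2.symm⟩
  set X : C(spectrum ℂ (φ u), ℂ) := (ContinuousMap.id ℂ).restrict (spectrum ℂ (φ u)) with hX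
  have hF : HasSum (fun n : ℕ => (c n : ℂ) • (X ^ n + star X ^ n)) 0 := by
    have hsum : Summable (fun n : ℕ => (c n : ℂ) • (X ^ n + star X ^ n)) := by
      refine Summable.of_norm_bounded (hcs.mul_right 2) fun n => ?_
      rw [ContinuousMap.norm_le _ (mul_nonneg (hc0 n) zero_le_two)]
      intro z
      have hz : ‖(z : ℂ)‖ = 1 := hnorm z z.2
      simp only [ContinuousMap.smul_apply, ContinuousMap.add_apply, ContinuousMap.pow_apply,
        ContinuousMap.star_apply, hX, ContinuousMap.restrict_apply, ContinuousMap.id_apply,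
        norm_smul, Complex.norm_real, Real.norm_of_nonneg (hc0 n)]
      refine mul_le_mul_of_nonneg_left ((norm_add_le _ _).trans ?_) (hc0 n)
      simp only [norm_pow, norm_star, hz]
      norm_num
    convert hsum.hasSum
    ext z
    obtain ⟨x, hx, hzx⟩ := harc z z.2
    rw [← ContinuousMap.tsum_apply hsum, ContinuousMap.zero_apply]
    have hre := (Complex.hasSum_ofReal.2 (hcos x hx)).mul_left 2
    rw [Complex.ofReal_zero, mul_zero] at hre
    rw [← hre.tsum_eq]
    congr 1
    ext n
    simp only [ContinuousMap.smul_apply, ContinuousMap.add_apply, ContinuousMap.pow_apply,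
        ContinuousMap.star_apply, hX, ContinuousMap.restrict_apply, ContinuousMap.id_apply, hzx]
    rw [Complex.star_def, ← Complex.exp_conj, ← Complex.exp_nat_mul, ← Complex.exp_nat_mul]
    simp only [map_mul, Complex.conj_I, Complex.conj_ofReal]
    rw [smul_eq_mul, Complex.ofReal_mul, Complex.ofReal_cos, Complex.cos]
    push_cast
    ring_nf
  have hsA : Summable (fun n : ℕ => (c n : ℂ) • (u ^ n + star u ^ n)) := by
    refine Summable.of_norm_bounded_eventually_nat (hcK.mul_left 2) ?_
    filter_upwards [eventually_ge_atTop 1] with n hn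
    rw [norm_smul, Complex.norm_real, Real.norm_of_nonneg (hc0 n)]
    calc _ ≤ c n * (Real.exp (K * (n : ℝ) ^ s) + Real.exp (K * (n : ℝ) ^ s)) := by
          refine mul_le_mul_of_nonneg_left ((norm_add_le _ _).trans ?_) (hc0 n)
          exact add_le_add (hK n hn) (hK' n hn)
      _ = _ := by ring
  have hzero : ∑' n : ℕ, (c n : ℂ) • (u ^ n + star u ^ n) = 0 := by
    apply hinj
    rw [map_zero]
    have hL := hsA.hasSum.map φ hcont
    have hR := hF.map (cfcHom hnormal) (cfcHom_continuous hnormal)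
    rw [map_zero] at hR
    refine hL.unique ?_
    convert! hR using 1
    ext n
    simp only [Function.comp_apply, map_smul, map_add, map_pow, map_star, hX, cfcHom_id]
  have htotal : HasSum (fun n : ℕ => (c n : ℂ) • (2 - u ^ n - star u ^ n))
      (((∑' n, c n : ℝ) : ℂ) • (2 : A)) := by
    have h2 := ((Complex.hasSum_ofReal.2 hcs.hasSum).smul_const (2 : A)).sub (hzero ▸ hsA.hasSum)
    rw [sub_zero] at h2
    convert! h2 using 1
    ext n
    rw [← smul_sub, sub_sub]
  by_contra hnon
  have hmem : ((∑' n, c n : ℝ) : ℂ) • (2 : A) ∈ nonunits A := by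
    refine nonunits.isClosed.mem_of_tendsto htotal (Eventually.of_forall fun T => ?_)
    choose z hz hz' using exists_commute_mul_eq_two_sub_pow_sub_pow hu' hu
    intro hT
    refine hnon (isUnit_of_mul_isUnit_of_commute (z := ∑ n ∈ T, (c n : ℂ) • z n)
      (Commute.sum_right _ _ _ fun n _ => (hz n).smul_right _) ?_)
    rw [Finset.mul_sum]
    simpa only [mul_smul_comm, hz'] using hT
  refine hmem ?_
  have hpos : 0 < ∑' n, c n := hc00.trans_le (hcs.le_tsum 0 fun n _ => hc0 n)
  have : ((∑' n, c n : ℝ) : ℂ) • (2 : A) = algebraMap ℂ A (((∑' n, c n : ℝ) : ℂ) * 2) := by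
    rw [map_mul, map_ofNat, Algebra.smul_def]
  rw [this]
  refine IsUnit.map _ (IsUnit.mk0 _ (mul_ne_zero ?_ two_ne_zero))
  exact_mod_cast hpos.ne'

open UniformSpace in
/-- The completion of a C⋆-normed unital algebra is a C⋆-algebra. -/
theorem exists_cstarAlgebra_completion (E : Type u) [NormedRing E] [StarRing E] [CStarRing E]
    [NormedAlgebra ℂ E] [StarModule ℂ E] :
    ∃ (D : Type u) (_ : CStarAlgebra D) (φ : E →⋆ₐ[ℂ] D), ∀ a, ‖φ a‖ = ‖a‖ := by
  have hstar : UniformContinuous (star : E → E) := (starₗᵢ ℂ (E := E)).isometry.uniformContinuous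
  let starC : Completion E → Completion E := Completion.map star
  have hcont : Continuous starC := Completion.continuous_map
  have hcoe : ∀ a : E, starC a = (star a : E) := fun a => Completion.map_coe hstar a
  have hsmul : ∀ (r : ℂ) (x : Completion E), starC (r • x) = star r • starC x := fun r x => by
    induction x using Completion.induction_on with
    | hp => exact isClosed_eq (hcont.comp (continuous_const_smul r)) ((continuous_const_smul (star r)).comp hcont)
    | ih a => rw [← Completion.coe_smul, hcoe, hcoe, star_smul, Completion.coe_smul]
  let _ : StarRing (Completion E) :=
    { star := starC
      star_involutive := fun x => by
        induction x using Completion.induction_on with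
        | hp => exact isClosed_eq (hcont.comp hcont) continuous_id
        | ih a => simp [hcoe]
      star_mul := fun x y => by
        induction x, y using Completion.induction_on₂ with
        | hp => exact isClosed_eq (by fun_prop) (by fun_prop)
        | ih a b => simp only [hcoe, ← Completion.coe_mul, star_mul]
      star_add := fun x y => by
        induction x, y using Completion.induction_on₂ with
        | hp => exact isClosed_eq (by fun_prop) (by fun_prop)
        | ih a b => simp only [hcoe, ← Completion.coe_add, star_add] }
  have : CStarRing (Completion E) :=
    { norm_mul_self_le := fun x => by
        change ‖x‖ * ‖x‖ ≤ ‖starC x * x‖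
        induction x using Completion.induction_on with
        | hp => exact isClosed_le (by fun_prop) (by fun_prop)
        | ih a =>
          simp only [hcoe, ← Completion.coe_mul, Completion.norm_coe]
          exact CStarRing.norm_mul_self_le a }
  let _ : NormedAlgebra ℂ (Completion E) := { norm_smul_le := norm_smul_le }
  have : StarModule ℂ (Completion E) :=
    ⟨hsmul⟩
  exact ⟨Completion E, { },
    { toFun := fun a => (a : Completion E)
      map_one' := Completion.coe_one E
      map_mul' := Completion.coe_mul
      map_zero' := Completion.coe_zero
      map_add' := Completion.coe_add
      commutes' := fun _ => rfl
      map_star' := fun a => (hcoe a).symm }, Completion.norm_coe⟩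

theorem exists_cstarAlgebra_norm_eq {A : Type u} [Ring A] [StarRing A] [Algebra ℂ A] [StarModule ℂ A]
    (γ : A → ℝ)
    (hγ_eq_zero : ∀ a : A, γ a = 0 ↔ a = 0)
    (hγ_smul : ∀ (c : ℂ) (a : A), γ (c • a) = ‖c‖ * γ a)
    (hγ_add : ∀ a b : A, γ (a + b) ≤ γ a + γ b)
    (hγ_mul : ∀ a b : A, γ (a * b) ≤ γ a * γ b)
    (hγ_cstar : ∀ a : A, γ (star a * a) = γ a ^ 2) :
    ∃ (D : Type u) (_ : CStarAlgebra D) (φ : A →⋆ₐ[ℂ] D), ∀ a, ‖φ a‖ = γ a := by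
  let N : RingNorm A :=
    { toFun := γ
      map_zero' := (hγ_eq_zero 0).2 rfl
      add_le' := hγ_add
      neg' := fun a => by simpa using hγ_smul (-1) a
      mul_le' := hγ_mul
      eq_zero_of_map_eq_zero' := fun a => (hγ_eq_zero a).1 }
  let _ : NormedRing A := N.toNormedRing
  let _ : NormedAlgebra ℂ A := { norm_smul_le := fun c a => (hγ_smul c a).le }
  have : CStarRing A := ⟨fun a => ((hγ_cstar a).trans (sq _)).ge⟩
  exact exists_cstarAlgebra_completion A

/-- Gelfand's formula for real norms, with the spectral radius attained in the spectrum. -/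
theorem exists_mem_spectrum_tendsto_norm_pow {A : Type*} [NormedRing A] [NormedAlgebra ℂ A]
    [CompleteSpace A] [Nontrivial A] (x : A) :
    ∃ z ∈ spectrum ℂ x, (∀ w ∈ spectrum ℂ x, ‖w‖ ≤ ‖z‖) ∧
      Tendsto (fun n : ℕ => ‖x ^ n‖ ^ (1 / n : ℝ)) atTop (𝓝 ‖z‖) := by
  obtain ⟨z, hz, hr⟩ := spectrum.exists_nnnorm_eq_spectralRadius x
  refine ⟨z, hz, fun w hw => ?_, ?_⟩
  · have : (‖w‖₊ : ENNReal) ≤ ‖z‖₊ := by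
      rw [hr]; exact le_iSup₂ (f := fun (k : ℂ) (_ : k ∈ spectrum ℂ x) => (‖k‖₊ : ENNReal)) w hw
    exact_mod_cast this
  · have h := spectrum.pow_norm_pow_one_div_tendsto_nhds_spectralRadius x
    rw [← hr] at h
    have h2 := (ENNReal.tendsto_toReal ENNReal.coe_ne_top).comp h
    refine h2.congr fun n => ?_
    simp only [Function.comp_apply]
    rw [ENNReal.toReal_ofReal (by positivity)]

theorem tendsto_const_rpow_one_div {c : ℝ} (hc : 0 < c) :
    Tendsto (fun n : ℕ => c ^ (1 / n : ℝ)) atTop (𝓝 1) := by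
  have := (Real.continuous_const_rpow hc.ne').tendsto 0
  rw [Real.rpow_zero] at this
  exact this.comp tendsto_one_div_atTop_nhds_zero_nat

section Differential

variable {A : Type u} {B : Type*}
    [NormedRing A] [StarRing A] [NormedAlgebra ℂ A]
    [NonUnitalNormedRing B] [StarRing B] [NormedSpace ℂ B]

theorem norm_map_pow_le (ι : A →⋆ₙₐ[ℂ] B) (x : A) {n : ℕ} (hn : 1 ≤ n) :
    ‖ι (x ^ n)‖ ≤ ‖ι x‖ ^ n := by
  induction n, hn using Nat.le_induction with
  | base => simp
  | succ n _ ih =>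
    rw [pow_succ, map_mul, pow_succ]
    exact (norm_mul_le _ _).trans (by gcongr)

theorem norm_map_pow_two_pow [CStarRing B] (ι : A →⋆ₙₐ[ℂ] B) {x : A} (hx : IsSelfAdjoint x) (m : ℕ) :
    ‖ι (x ^ 2 ^ m)‖ = ‖ι x‖ ^ 2 ^ m := by
  induction m with
  | zero => simp
  | succ m ih =>
    have h : IsSelfAdjoint (ι (x ^ 2 ^ m)) := (hx.pow _).map ι
    rw [pow_succ 2 m, pow_mul, pow_mul, ← ih, sq, map_mul, sq, ← CStarRing.norm_star_mul_self, h.star_eq]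

/-- A continuous `*`-homomorphism into a C⋆-algebra is bounded by the spectral radius on
self-adjoint elements. -/
theorem norm_map_le_of_tendsto [CStarRing B] (ι : A →⋆ₙₐ[ℂ] B) (hcont : Continuous ι) {x : A}
    (hx : IsSelfAdjoint x) {ρ : ℝ}
    (hρ : Tendsto (fun n : ℕ => ‖x ^ n‖ ^ (1 / n : ℝ)) atTop (𝓝 ρ)) : ‖ι x‖ ≤ ρ := by
  let f : A →L[ℂ] B := ⟨(ι : A →ₗ[ℂ] B), hcont⟩
  obtain ⟨M, hM, hbound⟩ := f.bound
  have hbound : ∀ a, ‖ι a‖ ≤ M * ‖a‖ := hbound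
  have hlim := ((tendsto_const_rpow_one_div hM).mul hρ).comp
    (tendsto_pow_atTop_atTop_of_one_lt (one_lt_two (α := ℕ)))
  rw [one_mul] at hlim
  refine ge_of_tendsto' hlim fun m => ?_
  have h := hbound (x ^ 2 ^ m)
  rw [norm_map_pow_two_pow ι hx] at h
  have h2 := Real.rpow_le_rpow (by positivity) h (by positivity : (0 : ℝ) ≤ 1 / ((2 ^ m : ℕ) : ℝ))
  rw [Real.mul_rpow hM.le (norm_nonneg _), one_div,
    Real.pow_rpow_inv_natCast (norm_nonneg _) (by positivity)] at h2
  simpa only [Function.comp_apply, one_div] using h2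

/-- Under the differential condition, the spectral radius in `A` is at most the norm in `B`. -/
theorem le_norm_map_of_tendsto (ι : A →⋆ₙₐ[ℂ] B)
    {k : ℕ} (hk : 2 ≤ k) {p q : ℝ} (hp : 0 < p) (hq : 0 < q) (hpq : p + q = (k : ℝ))
    {C : ℝ} (hC : 0 < C)
    (hdiff : ∀ a : A, ‖a ^ k‖ ≤ C * ‖a‖ ^ p * ‖ι a‖ ^ q) {x : A} {ρ : ℝ}
    (hρ : Tendsto (fun n : ℕ => ‖x ^ n‖ ^ (1 / n : ℝ)) atTop (𝓝 ρ)) : ρ ≤ ‖ι x‖ := by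
  have hρ0 : 0 ≤ ρ := ge_of_tendsto' hρ fun n => by positivity
  rcases hρ0.eq_or_lt with h0 | hρpos
  · rw [← h0]; exact norm_nonneg _
  have hL : Tendsto (fun n : ℕ => (‖x ^ (n * k)‖ ^ (1 / (n * k : ℕ) : ℝ)) ^ k) atTop
      (𝓝 (ρ ^ k)) :=
    (hρ.comp (tendsto_id.atTop_mul_const' (by lia : 0 < k))).pow k
  have hR : Tendsto (fun n : ℕ => C ^ (1 / n : ℝ) * (‖x ^ n‖ ^ (1 / n : ℝ)) ^ p * ‖ι x‖ ^ q) atTop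
      (𝓝 (1 * ρ ^ p * ‖ι x‖ ^ q)) :=
    ((tendsto_const_rpow_one_div hC).mul (hρ.rpow_const (Or.inr hp.le))).mul_const _
  have hle : ρ ^ k ≤ 1 * ρ ^ p * ‖ι x‖ ^ q := by
    refine le_of_tendsto_of_tendsto hL hR ?_
    filter_upwards [eventually_ge_atTop 1] with n hn
    have hn0 : (n : ℝ) ≠ 0 := by positivity
    have hk0 : (k : ℝ) ≠ 0 := by positivity
    have h1 : ‖x ^ (n * k)‖ ≤ C * ‖x ^ n‖ ^ p * (‖ι x‖ ^ n) ^ q := by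
      rw [pow_mul]
      refine (hdiff (x ^ n)).trans ?_
      gcongr
      exact norm_map_pow_le ι x hn
    have h2 := Real.rpow_le_rpow (norm_nonneg _) h1 (by positivity : (0 : ℝ) ≤ 1 / (n : ℝ))
    have e1 : (‖x ^ (n * k)‖ ^ (1 / (n * k : ℕ) : ℝ)) ^ k = ‖x ^ (n * k)‖ ^ (1 / (n : ℝ)) := by
      rw [← Real.rpow_natCast, ← Real.rpow_mul (norm_nonneg _)]
      congr 1
      push_cast
      field_simp
    have e2 : (C * ‖x ^ n‖ ^ p * (‖ι x‖ ^ n) ^ q) ^ (1 / (n : ℝ)) =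
        C ^ (1 / n : ℝ) * (‖x ^ n‖ ^ (1 / n : ℝ)) ^ p * ‖ι x‖ ^ q := by
      rw [Real.mul_rpow (by positivity) (by positivity), Real.mul_rpow hC.le (by positivity),
        ← Real.rpow_natCast ‖ι x‖, ← Real.rpow_mul (norm_nonneg (ι x)),
        ← Real.rpow_mul (norm_nonneg (ι x)), ← Real.rpow_mul (norm_nonneg _),
        ← Real.rpow_mul (norm_nonneg _)]
      congr 2
      · rw [mul_comm p]
      · field_simp
    rw [e1, ← e2]
    exact h2
  rw [one_mul, ← Real.rpow_natCast, ← hpq, Real.rpow_add hρpos] at hle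
  have := le_of_mul_le_mul_left hle (by positivity)
  exact (Real.rpow_le_rpow_iff hρ0 (norm_nonneg _) hq).1 this

/-- Under the differential condition, elements of norm at most one in `B` along all powers have
subexponentially growing powers in `A`. -/
theorem exists_norm_pow_le_exp (ι : A →⋆ₙₐ[ℂ] B)
    {k : ℕ} (hk : 2 ≤ k) {p q s : ℝ} (hp : 0 < p) (hq : 0 < q) (hs : 0 < s)
    (hps : p < (k : ℝ) ^ s) {C : ℝ}
    (hdiff : ∀ a : A, ‖a ^ k‖ ≤ C * ‖a‖ ^ p * ‖ι a‖ ^ q) {u : A}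
    (hu : ∀ n : ℕ, ‖ι (u ^ n)‖ ≤ 1) :
    ∃ K : ℝ, ∀ n : ℕ, 1 ≤ n → ‖u ^ n‖ ≤ Real.exp (K * (n : ℝ) ^ s) := by
  set W : ℕ → ℝ := fun n => max 1 ‖u ^ n‖ with hW
  have hW1 : ∀ n, 1 ≤ W n := fun n => le_max_left _ _
  have hW0 : ∀ n, 0 < W n := fun n => one_pos.trans_le (hW1 n)
  set C' : ℝ := max 1 C with hC'
  have hC'1 : 1 ≤ C' := le_max_left _ _
  have hmul : ∀ n, W (n * k) ≤ C' * W n ^ p := fun n => by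
    have hWp : 1 ≤ W n ^ p := Real.one_le_rpow (hW1 n) hp.le
    refine max_le (one_le_mul_of_one_le_of_one_le hC'1 hWp) ?_
    rw [pow_mul]
    calc _ ≤ C * ‖u ^ n‖ ^ p * ‖ι (u ^ n)‖ ^ q := hdiff _
      _ ≤ C' * ‖u ^ n‖ ^ p * ‖ι (u ^ n)‖ ^ q := by gcongr; exact le_max_right _ _
      _ ≤ C' * ‖u ^ n‖ ^ p := mul_le_of_le_one_right (by positivity)
          (Real.rpow_le_one (norm_nonneg _) (hu n) hq.le)
      _ ≤ C' * W n ^ p := by gcongr; exact le_max_right _ _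
  have hadd : ∀ n m, W (n + m) ≤ W n * W 1 ^ m := fun n m => by
    induction m with
    | zero => simp
    | succ m ih =>
      calc W (n + (m + 1)) ≤ W (n + m) * W 1 := by
            refine max_le (one_le_mul_of_one_le_of_one_le (hW1 _) (hW1 _)) ?_
            rw [← add_assoc, pow_succ]
            refine (norm_mul_le _ _).trans ?_
            exact mul_le_mul (le_max_right _ _) (by simp [hW]) (norm_nonneg _) (hW0 _).le
        _ ≤ W n * W 1 ^ m * W 1 := by gcongr
        _ = W n * W 1 ^ (m + 1) := by ring
  have hlog : ∀ n, Real.log (W n) ≤ (Real.log C' + k * Real.log (W 1)) + p * Real.log (W (n / k)) :=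
      fun n => by
    have h1 : W n ≤ C' * W (n / k) ^ p * W 1 ^ k := by
      calc W n = W (n / k * k + n % k) := by rw [Nat.div_add_mod']
        _ ≤ W (n / k * k) * W 1 ^ (n % k) := hadd _ _
        _ ≤ C' * W (n / k) ^ p * W 1 ^ k := by
            have := hW0 (n / k)
            gcongr
            · exact hmul _
            · exact hW1 1
            · exact (Nat.mod_lt _ (by lia)).le
    have h2 := Real.log_le_log (hW0 n) h1
    have hp1 : 0 < W (n / k) ^ p := Real.rpow_pos_of_pos (hW0 _) _
    have hp2 : 0 < W 1 ^ k := pow_pos (hW0 1) k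
    rw [Real.log_mul (by positivity) hp2.ne', Real.log_mul (by positivity) hp1.ne',
      Real.log_rpow (hW0 _), Real.log_pow] at h2
    linarith
  have hl1 : ∀ n, 0 ≤ Real.log (W n) := fun n => Real.log_nonneg (hW1 n)
  obtain ⟨K, hK⟩ := exists_le_mul_rpow_of_le_add_mul_div (L := fun n => Real.log (W n)) hk hp
    (add_nonneg (Real.log_nonneg hC'1) (mul_nonneg (by positivity) (hl1 1))) (hl1 0) hs hps hlog
  refine ⟨K, fun n hn => ?_⟩
  exact (le_max_right _ _).trans ((Real.log_le_iff_le_exp (hW0 n)).1 (hK n hn))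

/-- A unitary is sent to an element of norm at most one. -/
theorem norm_map_le_one_of_star_mul_self [CStarRing B] (ι : A →⋆ₙₐ[ℂ] B) {u : A}
    (hu : star u * u = 1) : ‖ι u‖ ≤ 1 := by
  have h1 : ‖ι (1 : A)‖ ≤ 1 := by
    have h : ‖ι (1 : A)‖ * ‖ι (1 : A)‖ = ‖ι (1 : A)‖ := by
      rw [← CStarRing.norm_star_mul_self, ← map_star, ← map_mul, star_one, one_mul]
    nlinarith [norm_nonneg (ι (1 : A))]
  have h2 : ‖ι u‖ * ‖ι u‖ = ‖ι (1 : A)‖ := by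
    rw [← CStarRing.norm_star_mul_self, ← map_star, ← map_mul, hu]
  nlinarith [norm_nonneg (ι u)]

/-- Spectral invariance for unitaries: an injective `*`-homomorphism from a differential subalgebra
into a C⋆-algebra does not shrink the spectrum of a unitary. -/
theorem mem_spectrum_map_of_mem_spectrum [CompleteSpace A] [StarModule ℂ A] [CStarRing B]
    (ι : A →⋆ₙₐ[ℂ] B)
    {k : ℕ} (hk : 2 ≤ k) {p q : ℝ} (hp : 0 < p) (hq : 0 < q) (hpq : p + q = (k : ℝ)) {C : ℝ}
    (hdiff : ∀ a : A, ‖a ^ k‖ ≤ C * ‖a‖ ^ p * ‖ι a‖ ^ q)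
    {D : Type*} [CStarAlgebra D] (φ : A →⋆ₐ[ℂ] D) (hinj : Function.Injective φ)
    (hcont : Continuous φ) {u : A} (hu : u ∈ unitary A) {z : ℂ} (hz1 : ‖z‖ = 1)
    (hz : z ∈ spectrum ℂ u) : z ∈ spectrum ℂ (φ u) := by
  have hz0 : z ≠ 0 := norm_ne_zero_iff.1 (hz1 ▸ one_ne_zero)
  have hzz : z * star z = 1 := by
    rw [Complex.star_def, Complex.mul_conj, Complex.normSq_eq_norm_sq, hz1]; simp
  set v : A := star z • u with hv
  have hvmem : v ∈ unitary A := by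
    rw [Unitary.mem_iff, hv, star_smul, star_star, smul_mul_smul_comm, smul_mul_smul_comm,
      mul_comm (star z), hzz, hu.1, hu.2, one_smul]
    exact ⟨rfl, rfl⟩
  obtain ⟨s, hs0, hs1, hps⟩ := exists_lt_natCast_rpow hk (p := p) (by linarith)
  obtain ⟨K₁, hK₁⟩ := exists_norm_pow_le_exp ι hk hp hq hs0 hps hdiff (u := v)
    fun n => norm_map_le_one_of_star_mul_self ι (pow_mem hvmem n).1
  obtain ⟨K₂, hK₂⟩ := exists_norm_pow_le_exp ι hk hp hq hs0 hps hdiff (u := star v)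
    fun n => norm_map_le_one_of_star_mul_self ι (pow_mem (Unitary.star_mem hvmem) n).1
  by_contra hnot
  rw [spectrum.notMem_iff, Algebra.algebraMap_eq_smul_one] at hnot
  refine hz ?_
  have hD : z • (1 : D) - φ u = Units.mk0 z hz0 • (1 - φ v) := by
    rw [hv, map_smul, Units.smul_mk0, smul_sub, smul_smul, hzz, one_smul]
  have hA : algebraMap ℂ A z - u = Units.mk0 z hz0 • (1 - v) := by
    rw [hv, Algebra.algebraMap_eq_smul_one, Units.smul_mk0, smul_sub, smul_smul, hzz, one_smul]
  rw [hD, isUnit_smul_iff] at hnot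
  rw [spectrum.mem_resolventSet_iff, hA, isUnit_smul_iff]
  refine isUnit_one_sub_of_isUnit_map φ hinj hcont hvmem.1 hvmem.2 hs0 hs1 (K := max K₁ K₂)
    (fun n hn => (hK₁ n hn).trans ?_) (fun n hn => (hK₂ n hn).trans ?_) hnot
  · gcongr; exact le_max_left _ _
  · gcongr; exact le_max_right _ _

/-- The spectrum of the exponential of a normal element of a C⋆-algebra. -/
theorem exists_mem_spectrum_exp_eq {D : Type*} [CStarAlgebra D] {a : D} (ha : IsStarNormal a)
    {z : ℂ} (hz : z ∈ spectrum ℂ (NormedSpace.exp a)) : ∃ w ∈ spectrum ℂ a, Complex.exp w = z := by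
  rw [← CFC.exp_eq_normedSpace_exp (𝕜 := ℂ), cfc_map_spectrum (R := ℂ) NormedSpace.exp a ha (by fun_prop)] at hz
  simpa only [← Complex.exp_eq_exp_ℂ, Set.mem_image] using hz

/-- Self-adjoint elements have the same spectral radius in a differential subalgebra and in any
C⋆-algebra into which it embeds. -/
theorem norm_le_norm_map_of_mem_spectrum [CompleteSpace A] [StarModule ℂ A] [ContinuousStar A]
    [Nontrivial A] [CStarRing B] (ι : A →⋆ₙₐ[ℂ] B)
    {k : ℕ} (hk : 2 ≤ k) {p q : ℝ} (hp : 0 < p) (hq : 0 < q) (hpq : p + q = (k : ℝ)) {C : ℝ}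
    (hC : 0 < C) (hdiff : ∀ a : A, ‖a ^ k‖ ≤ C * ‖a‖ ^ p * ‖ι a‖ ^ q)
    {D : Type*} [CStarAlgebra D] (φ : A →⋆ₐ[ℂ] D) (hinj : Function.Injective φ)
    (hcont : Continuous φ) {x : A} (hx : IsSelfAdjoint x) {z : ℂ} (hz : z ∈ spectrum ℂ x) :
    ‖z‖ ≤ ‖φ x‖ := by
  let _ : NormedAlgebra ℚ A := .restrictScalars ℚ ℂ A
  have hspec : ∀ v ∈ unitary A, ∀ w ∈ spectrum ℂ v, ‖w‖ ≤ 1 := fun v hv w hw => by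
    obtain ⟨y, -, hmax, hy⟩ := exists_mem_spectrum_tendsto_norm_pow v
    exact (hmax w hw).trans ((le_norm_map_of_tendsto ι hk hp hq hpq hC hdiff hy).trans
      (norm_map_le_one_of_star_mul_self ι hv.1))
  have : Nontrivial D := hinj.nontrivial
  set t : ℝ := (‖z‖ + ‖φ x‖ + 1)⁻¹ with ht
  have ht0 : 0 < t := by positivity
  have hI : (t : ℂ) * Complex.I ≠ 0 := mul_ne_zero (by exact_mod_cast ht0.ne') Complex.I_ne_zero
  have hskew : ∀ r : ℝ, ((r : ℂ) * Complex.I) • x ∈ skewAdjoint A := fun r => by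
    rw [skewAdjoint.mem_iff, star_smul, hx.star_eq, ← neg_smul]
    simp
  have hexp : ∀ r : ℝ, r ≠ 0 →
      NormedSpace.exp (((r : ℂ) * Complex.I) • x) ∈ unitary A ∧
      Complex.exp ((r : ℂ) * Complex.I * z) ∈
        spectrum ℂ (NormedSpace.exp (((r : ℂ) * Complex.I) • x)) := fun r hr => by
    refine ⟨NormedSpace.exp_mem_unitary_of_mem_skewAdjoint (hskew r), ?_⟩
    rw [Complex.exp_eq_exp_ℂ]
    refine spectrum.exp_mem_exp _ ?_
    rw [spectrum.smul_eq_smul _ _ (spectrum.nonempty x)]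
    exact Set.smul_mem_smul_set hz
  have hnorm : ‖Complex.exp ((t : ℂ) * Complex.I * z)‖ = 1 := by
    have h1 := hspec _ (hexp t ht0.ne').1 _ (hexp t ht0.ne').2
    have h2 := hspec _ (hexp (-t) (neg_ne_zero.2 ht0.ne')).1 _ (hexp (-t) (neg_ne_zero.2 ht0.ne')).2
    rw [show ((-t : ℝ) : ℂ) * Complex.I * z = -((t : ℂ) * Complex.I * z) by push_cast; ring,
      Complex.exp_neg, norm_inv] at h2
    exact le_antisymm h1 ((inv_le_one₀ (norm_pos_iff.2 (Complex.exp_ne_zero _))).1 h2)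
  have hmem := mem_spectrum_map_of_mem_spectrum ι hk hp hq hpq hdiff φ hinj hcont
    (hexp t ht0.ne').1 hnorm (hexp t ht0.ne').2
  let _ : Algebra ℚ D := Algebra.restrictScalars ℚ ℂ D
  rw [NormedSpace.map_exp φ hcont, map_smul] at hmem
  have hsa : IsSelfAdjoint (φ x) := hx.map φ
  have hnormal : IsStarNormal (((t : ℂ) * Complex.I) • φ x) := by
    have := hsa.isStarNormal
    infer_instance
  obtain ⟨y, hy, hyz⟩ := exists_mem_spectrum_exp_eq hnormal hmem
  rw [spectrum.smul_eq_smul _ _ (spectrum.nonempty (φ x))] at hy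
  obtain ⟨w, hw, rfl⟩ := hy
  simp only [smul_eq_mul] at hyz
  have hwn : ‖w‖ ≤ ‖φ x‖ := spectrum.norm_le_norm_of_mem hw
  suffices h : w = z from h ▸ hwn
  obtain ⟨m, hm⟩ := Complex.exp_eq_exp_iff_exists_int.1 hyz
  have hm2 : ‖(t : ℂ) * Complex.I * (w - z)‖ = |(m : ℝ)| * (2 * Real.pi) := by
    rw [mul_sub, hm, add_sub_cancel_left]
    simp [abs_of_pos Real.pi_pos]
  have hlt : ‖(t : ℂ) * Complex.I * (w - z)‖ < 1 := by
    rw [norm_mul, norm_mul, Complex.norm_I, mul_one, Complex.norm_real, Real.norm_of_nonneg ht0.le,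
      ht, inv_mul_lt_iff₀ (by positivity), mul_one]
    linarith [norm_sub_le w z]
  have hm0 : m = 0 := by
    by_contra hne
    have : (1 : ℝ) ≤ |(m : ℝ)| := by exact_mod_cast Int.one_le_abs hne
    nlinarith [Real.pi_gt_three]
  rw [hm0, Int.cast_zero, zero_mul, add_zero] at hm
  exact mul_left_cancel₀ hI hm

end Differential

/-- A `(k,p,q)`-differential subalgebra is C*-unique: any C*-norm `γ`
on `A` coincides with `a ↦ ‖ι a‖`. -/
theorem stmt8
    {A B : Type*}
    [NormedRing A] [StarRing A] [NormedAlgebra ℂ A] [CompleteSpace A]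
    [NonUnitalNormedRing B] [StarRing B] [CStarRing B] [NormedSpace ℂ B]
    [IsScalarTower ℂ B B] [SMulCommClass ℂ B B] [StarModule ℂ B] [CompleteSpace B]
    (hstar : Continuous (star : A → A))
    (ι : A →⋆ₙₐ[ℂ] B) (hinj : Function.Injective ι) (hcont : Continuous ι)
    (k : ℕ) (hk : 2 ≤ k) (p q : ℝ) (hp : 0 < p) (hq : 0 < q) (hpq : p + q = (k : ℝ))
    (C : ℝ) (hC : 0 < C)
    (hdiff : ∀ a : A, ‖a ^ k‖ ≤ C * ‖a‖ ^ p * ‖ι a‖ ^ q)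
    (γ : A → ℝ)
    (hγ_nonneg : ∀ a : A, 0 ≤ γ a)
    (hγ_eq_zero : ∀ a : A, γ a = 0 ↔ a = 0)
    (hγ_smul : ∀ (c : ℂ) (a : A), γ (c • a) = ‖c‖ * γ a)
    (hγ_add : ∀ a b : A, γ (a + b) ≤ γ a + γ b)
    (hγ_mul : ∀ a b : A, γ (a * b) ≤ γ a * γ b)
    (hγ_cstar : ∀ a : A, γ (star a * a) = γ a ^ 2) :
    ∀ a : A, γ a = ‖ι a‖ := by
  have : StarModule ℂ A := ⟨fun r a => hinj (by simp only [map_star, map_smul, star_smul])⟩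
  have : ContinuousStar A := ⟨hstar⟩
  rcases subsingleton_or_nontrivial A with hA | hA
  · intro a
    rw [Subsingleton.elim a 0, map_zero, norm_zero, hγ_eq_zero]
  obtain ⟨D, _, φ, hφ⟩ := exists_cstarAlgebra_norm_eq γ hγ_eq_zero hγ_smul hγ_add hγ_mul hγ_cstar
  have hφinj : Function.Injective φ := (injective_iff_map_eq_zero φ).2 fun a ha => by
    rw [← hγ_eq_zero, ← hφ, ha, norm_zero]
  have : Nontrivial D := hφinj.nontrivial
  have hsq : ∀ a : A, ‖ι (star a * a)‖ = ‖ι a‖ ^ 2 := fun a => by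
    rw [map_mul, map_star, CStarRing.norm_star_mul_self, sq]
  have hle_sa : ∀ x : A, IsSelfAdjoint x → γ x ≤ ‖ι x‖ := fun x hx => by
    obtain ⟨z, -, hmax, hz⟩ := exists_mem_spectrum_tendsto_norm_pow x
    obtain ⟨w, hw, -, hw'⟩ := exists_mem_spectrum_tendsto_norm_pow (φ x)
    have h1 : ‖φ x‖ ≤ ‖w‖ :=
      norm_map_le_of_tendsto (NonUnitalStarAlgHom.id ℂ D) continuous_id (hx.map φ) hw'
    have h2 : ‖w‖ ≤ ‖z‖ := hmax w (AlgHom.spectrum_apply_subset φ x hw)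
    rw [← hφ]
    exact h1.trans (h2.trans (le_norm_map_of_tendsto ι hk hp hq hpq hC hdiff hz))
  have hle : ∀ a : A, γ a ≤ ‖ι a‖ := fun a => by
    have h := hle_sa _ (IsSelfAdjoint.star_mul_self a)
    rw [hγ_cstar, hsq] at h
    exact (sq_le_sq₀ (hγ_nonneg a) (norm_nonneg _)).1 h
  have hφcont : Continuous φ := by
    obtain ⟨M, -, hM⟩ := (⟨(ι : A →ₗ[ℂ] B), hcont⟩ : A →L[ℂ] B).bound
    exact AddMonoidHomClass.continuous_of_bound φ M fun a =>
      ((hφ a).trans_le (hle a)).trans (hM a)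
  intro a
  refine le_antisymm (hle a) ?_
  have hx := IsSelfAdjoint.star_mul_self a
  obtain ⟨z, hz, -, hlim⟩ := exists_mem_spectrum_tendsto_norm_pow (star a * a)
  have h := (norm_map_le_of_tendsto ι hcont hx hlim).trans
    (norm_le_norm_map_of_mem_spectrum ι hk hp hq hpq hC hdiff φ hφinj hφcont hx hz)
  rw [hφ, hγ_cstar, hsq] at h
  exact (sq_le_sq₀ (norm_nonneg _) (hγ_nonneg a)).1 h
end
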